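/- arXiv:1205.1892 — 2 statements merged into one kernel-verified Lean document; each statement's English description precedes it below -/
import Mathlib

section
/- Uniform-in-scale Lipschitz continuity of wavelet projections: Let φ : ℝ → ℝ be a Lipschitz continuous, compactly supported function with ∫_ℝ φ(x) dx = 1 satisfying the reproducing property ∫_ℝ Σ_{l∈ℤ} φ(y − l) φ(z − l) dz = 1 for all y ∈ ℝ. For j ∈ ℤ and k = (k_1,…,k_d) ∈ ℤ^d define Φ_{j,k} : ℝ^d → ℝ by Φ_{j,k}(x) = 2^{jd/2} Π_{i=1}^d φ(2^j x_i − k_i). Let g : ℝ^d → ℝ be Lipschitz continuous and bounded, and define g_j(x) = Σ_{k∈ℤ^d} α_{j,k} Φ_{j,k}(x) with α_{j,k} = ∫_{ℝ^d} g(x) Φ_{j,k}(x) dx (for each x the sum has finitely many nonzero terms since φ has compact support). Then there exists a constant C < ∞, depending only on g, φ and d but not on j, such that g_j is Lipschitz continuous with constant C for every j ∈ ℤ. -/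
open MeasureTheory

/-- The multi-indices `k` with `|x i - k i| ≤ S` for all `i`. -/
noncomputable def latticeBox {d : ℕ} (x : Fin d → ℝ) (S : ℕ) : Finset (Fin d → ℤ) :=
  Fintype.piFinset fun i => Finset.Icc ⌈x i - S⌉ ⌊x i + S⌋

lemma mem_Icc_ceil_floor {t : ℝ} {S : ℕ} {l : ℤ} :
    l ∈ Finset.Icc ⌈t - S⌉ ⌊t + S⌋ ↔ |t - l| ≤ S := by
  rw [Finset.mem_Icc, Int.ceil_le, Int.le_floor, abs_le]
  constructor <;> rintro ⟨h₁, h₂⟩ <;> constructor <;> linarith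

lemma mem_latticeBox {d : ℕ} {x : Fin d → ℝ} {S : ℕ} {k : Fin d → ℤ} :
    k ∈ latticeBox x S ↔ ∀ i, |x i - k i| ≤ S := by
  simp only [latticeBox, Fintype.mem_piFinset, mem_Icc_ceil_floor]

lemma card_latticeBox_le {d : ℕ} (x : Fin d → ℝ) (S : ℕ) :
    (latticeBox x S).card ≤ (2 * S + 1) ^ d := by
  rw [latticeBox, Fintype.card_piFinset]
  calc ∏ i, (Finset.Icc ⌈x i - S⌉ ⌊x i + S⌋).card ≤ ∏ _i : Fin d, (2 * S + 1) := by
        refine Finset.prod_le_prod' fun i _ => ?_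
        rw [Int.card_Icc, Int.toNat_le]
        have h₁ := Int.floor_le (x i + S)
        have h₂ := Int.le_ceil (x i - S)
        have h : ((⌊x i + S⌋ - ⌈x i - S⌉ : ℤ) : ℝ) ≤ ((2 * S : ℤ) : ℝ) := by
          push_cast
          linarith
        have h' : ⌊x i + S⌋ - ⌈x i - S⌉ ≤ 2 * S := Int.cast_le.mp h
        push_cast
        linarith
    _ = (2 * S + 1) ^ d := by simp

lemma abs_sum_latticeBox_le {d : ℕ} (x : Fin d → ℝ) (S : ℕ) {f : (Fin d → ℤ) → ℝ} {c : ℝ}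
    (hc : 0 ≤ c) (hf : ∀ k ∈ latticeBox x S, |f k| ≤ c) :
    |∑ k ∈ latticeBox x S, f k| ≤ (2 * S + 1) ^ d * c := by
  refine (Finset.abs_sum_le_sum_abs _ _).trans ((Finset.sum_le_card_nsmul _ _ _ hf).trans ?_)
  rw [nsmul_eq_mul]
  gcongr
  exact_mod_cast card_latticeBox_le x S

lemma abs_prod_sub_prod_le {ι : Type*} (s : Finset ι) (a b : ι → ℝ) {M : ℝ} (hM : 1 ≤ M)
    (ha : ∀ i, |a i| ≤ M) (hb : ∀ i, |b i| ≤ M) :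
    |∏ i ∈ s, a i - ∏ i ∈ s, b i| ≤ M ^ s.card * ∑ i ∈ s, |a i - b i| := by
  classical
  induction s using Finset.induction_on with
  | empty => simp
  | insert i s hi ih =>
    rw [Finset.prod_insert hi, Finset.prod_insert hi, Finset.sum_insert hi,
      Finset.card_insert_of_notMem hi]
    have hB : |∏ i ∈ s, b i| ≤ M ^ s.card := by
      rw [Finset.abs_prod]
      exact (Finset.prod_le_prod (fun _ _ => abs_nonneg _) fun i _ => hb i).trans_eq (by simp)
    have hMs : M ^ s.card ≤ M ^ (s.card + 1) := pow_le_pow_right₀ hM (Nat.le_succ _)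
    calc |a i * ∏ i ∈ s, a i - b i * ∏ i ∈ s, b i|
        = |a i * (∏ i ∈ s, a i - ∏ i ∈ s, b i) + (a i - b i) * ∏ i ∈ s, b i| := by
          congr 1
          ring
      _ ≤ |a i| * |∏ i ∈ s, a i - ∏ i ∈ s, b i| + |a i - b i| * |∏ i ∈ s, b i| := by
          rw [← abs_mul, ← abs_mul]
          exact abs_add_le _ _
      _ ≤ M * (M ^ s.card * ∑ i ∈ s, |a i - b i|) + |a i - b i| * M ^ (s.card + 1) := by
          gcongr
          · exact ha i
          · exact hB.trans hMs
      _ = M ^ (s.card + 1) * (|a i - b i| + ∑ i ∈ s, |a i - b i|) := by ring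

section Quasiprojection

variable {d : ℕ} {F : (Fin d → ℝ) → ℝ} {R : ℕ}

lemma hasCompactSupport_of_box (hsupp : ∀ x, F x ≠ 0 → ∀ i, |x i| ≤ R) : HasCompactSupport F := by
  refine HasCompactSupport.intro (isCompact_closedBall 0 (R : ℝ)) fun x hx => ?_
  by_contra h
  refine hx ?_
  rw [mem_closedBall_zero_iff, pi_norm_le_iff_of_nonneg (Nat.cast_nonneg R)]
  exact hsupp x h

lemma continuous_of_l1_lipschitz {G : (Fin d → ℝ) → ℝ} {L : ℝ}
    (hG : ∀ x y, |G x - G y| ≤ L * ∑ i, |x i - y i|) : Continuous G := by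
  refine continuous_iff_continuousAt.2 fun y => ?_
  rw [ContinuousAt, tendsto_iff_dist_tendsto_zero]
  refine squeeze_zero (fun _ => dist_nonneg) (fun x => hG x y) ?_
  have h : Continuous fun x : Fin d → ℝ => L * ∑ i, |x i - y i| := by fun_prop
  simpa using h.tendsto y

/-- The coefficient of a Lipschitz `G` against a translate of `F` is close to the values of `G`
near the support of that translate. -/
lemma abs_coeff_sub_le (hF : Continuous F) (hsupp : ∀ x, F x ≠ 0 → ∀ i, |x i| ≤ R)
    (hint : ∫ x, F x = 1) {G : (Fin d → ℝ) → ℝ} {L : ℝ} (hL : 0 ≤ L)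
    (hG : ∀ x y, |G x - G y| ≤ L * ∑ i, |x i - y i|) (S : ℕ) (x : Fin d → ℝ) (k : Fin d → ℤ)
    (hk : k ∈ latticeBox x S) :
    |(∫ v, G v * F (v - fun i => (k i : ℝ))) - G x| ≤ L * (d * (R + S)) * ∫ v, |F v| := by
  set κ : Fin d → ℝ := fun i => (k i : ℝ)
  have hc : HasCompactSupport fun v => F (v - κ) :=
    (hasCompactSupport_of_box hsupp).comp_homeomorph (Homeomorph.subRight κ)
  have hFc : Continuous fun v => F (v - κ) := by fun_prop
  have hGc := continuous_of_l1_lipschitz hG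
  have hi₁ : Integrable fun v => G v * F (v - κ) :=
    (hGc.mul hFc).integrable_of_hasCompactSupport hc.mul_left
  have hi₂ : Integrable fun v => F (v - κ) := hFc.integrable_of_hasCompactSupport hc
  have h1 : ∫ v, F (v - κ) = 1 := by rw [integral_sub_right_eq_self F κ, hint]
  have heq : (∫ v, G v * F (v - κ)) - G x = ∫ v, (G v - G x) * F (v - κ) := by
    simp_rw [sub_mul]
    rw [integral_sub hi₁ (hi₂.const_mul _), integral_const_mul, h1, mul_one]
  rw [heq, ← integral_sub_right_eq_self (fun v => |F v|) κ, ← integral_const_mul]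
  refine (abs_integral_le_integral_abs).trans (integral_mono_of_nonneg
    (Filter.Eventually.of_forall fun _ => abs_nonneg _) (hi₂.abs.const_mul _)
    (Filter.Eventually.of_forall fun v => ?_))
  simp only [abs_mul]
  by_cases hv : F (v - κ) = 0
  · simp [hv]
  gcongr
  refine (hG v x).trans ?_
  gcongr
  calc ∑ i, |v i - x i| ≤ ∑ _i : Fin d, ((R : ℝ) + S) := by
        refine Finset.sum_le_sum fun i _ => ?_
        have h₁ := abs_le.1 (hsupp _ hv i)
        have h₂ := abs_le.1 (mem_latticeBox.1 hk i)
        simp only [Pi.sub_apply, κ] at h₁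
        rw [abs_le]
        constructor <;> linarith [h₁.1, h₁.2, h₂.1, h₂.2]
    _ = d * (R + S) := by simp [mul_add]

/-- The quasi-projection onto the integer translates of `F` maps Lipschitz functions to Lipschitz
functions, with a Lipschitz constant proportional to that of the input. -/
lemma exists_lipschitz_quasiprojection {D B : ℝ}
    (hlip : ∀ x y, |F x - F y| ≤ D * ∑ i, |x i - y i|)
    (hB : ∀ x, |F x| ≤ B) (hsupp : ∀ x, F x ≠ 0 → ∀ i, |x i| ≤ R)
    (hint : ∫ x, F x = 1) (hsum : ∀ x, ∑' k : Fin d → ℤ, F (x - fun i => (k i : ℝ)) = 1) :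
    ∃ C : ℝ, ∀ (G : (Fin d → ℝ) → ℝ) (L : ℝ), 0 ≤ L →
      (∀ x y, |G x - G y| ≤ L * ∑ i, |x i - y i|) → ∀ x y,
      |(∑' k : Fin d → ℤ, (∫ v, G v * F (v - fun i => (k i : ℝ))) * F (x - fun i => (k i : ℝ))) -
        ∑' k : Fin d → ℤ, (∫ v, G v * F (v - fun i => (k i : ℝ))) * F (y - fun i => (k i : ℝ))|
        ≤ C * L * ∑ i, |x i - y i| := by
  have hF := continuous_of_l1_lipschitz hlip
  have hB0 : 0 ≤ B := (abs_nonneg _).trans (hB 0)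
  set A : ℝ := ∫ v, |F v|
  have hA : 0 ≤ A := integral_nonneg fun _ => abs_nonneg _
  set S : ℕ := R + 1 with hS
  set N : ℝ := (2 * S + 1) ^ d
  have hN : 0 ≤ N := by positivity
  set E : ℝ := d * (R + S) * A
  have hE : 0 ≤ E := by positivity
  refine ⟨max (N * (E * D)) (2 * (N * (E * B)) + 1), fun G L hL hG x y => ?_⟩
  set b : (Fin d → ℤ) → ℝ := fun k => ∫ v, G v * F (v - fun i => (k i : ℝ))
  have hb : ∀ x, ∀ k ∈ latticeBox x S, |b k - G x| ≤ L * E := fun x k hk =>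
    (abs_coeff_sub_le hF hsupp hint hL hG S x k hk).trans_eq (by ring)
  have hzero : ∀ x y : Fin d → ℝ, ∑ i, |x i - y i| ≤ 1 → ∀ k ∉ latticeBox x S,
      F (y - fun i => (k i : ℝ)) = 0 := by
    intro x y hxy k hk
    by_contra h
    refine hk (mem_latticeBox.2 fun i => ?_)
    have h₁ := hsupp _ h i
    have h₂ := (Finset.single_le_sum (f := fun i => |x i - y i|) (fun i _ => abs_nonneg _)
      (Finset.mem_univ i)).trans hxy
    simp only [Pi.sub_apply] at h₁
    calc |x i - k i| ≤ |x i - y i| + |y i - k i| := abs_sub_le _ _ _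
      _ ≤ 1 + R := add_le_add h₂ h₁
      _ = S := by
        rw [hS]
        push_cast
        ring
  have hone : ∀ x y : Fin d → ℝ, ∑ i, |x i - y i| ≤ 1 →
      ∑ k ∈ latticeBox x S, F (y - fun i => (k i : ℝ)) = 1 := fun x y hxy => by
    rw [← hsum y, tsum_eq_sum (hzero x y hxy)]
  have hproj : ∀ x y : Fin d → ℝ, ∑ i, |x i - y i| ≤ 1 →
      (∑' k, b k * F (y - fun i => (k i : ℝ))) - G x =
        ∑ k ∈ latticeBox x S, (b k - G x) * F (y - fun i => (k i : ℝ)) := fun x y hxy => by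
    rw [tsum_eq_sum (s := latticeBox x S) fun k hk => by rw [hzero x y hxy k hk, mul_zero]]
    simp_rw [sub_mul]
    rw [Finset.sum_sub_distrib, ← Finset.mul_sum, hone x y hxy, mul_one]
  have hself : ∀ x : Fin d → ℝ, ∑ i, |x i - x i| ≤ 1 := fun x => by simp
  have hxy₀ : 0 ≤ ∑ i, |x i - y i| := Finset.sum_nonneg fun _ _ => abs_nonneg _
  rcases le_or_gt (∑ i, |x i - y i|) 1 with hxy | hxy
  · have key : |(∑' k, b k * F (x - fun i => (k i : ℝ))) -
        ∑' k, b k * F (y - fun i => (k i : ℝ))| ≤ N * (L * E * (D * ∑ i, |x i - y i|)) := by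
      rw [← sub_sub_sub_cancel_right _ _ (G x), hproj x x (hself x), hproj x y hxy,
        ← Finset.sum_sub_distrib]
      have hD := (abs_nonneg _).trans (hlip x y)
      refine abs_sum_latticeBox_le x S (by positivity) fun k hk => ?_
      rw [← mul_sub, abs_mul]
      refine mul_le_mul (hb x k hk) ((hlip _ _).trans_eq ?_) (abs_nonneg _) (by positivity)
      simp
    calc _ ≤ _ := key
      _ = N * (E * D) * L * ∑ i, |x i - y i| := by ring
      _ ≤ _ := by
        gcongr
        exact le_max_left _ _
  · have hnear : ∀ x, |(∑' k, b k * F (x - fun i => (k i : ℝ))) - G x| ≤ N * (L * E * B) := by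
      intro x
      rw [hproj x x (hself x)]
      refine abs_sum_latticeBox_le x S (by positivity) fun k hk => ?_
      rw [abs_mul]
      exact mul_le_mul (hb x k hk) (hB _) (abs_nonneg _) (by positivity)
    have hx := abs_le.1 (hnear x)
    have hy := abs_le.1 (hnear y)
    have hg := abs_le.1 (hG x y)
    have hP : 0 ≤ N * (L * E * B) := by positivity
    have hP' := mul_le_mul_of_nonneg_left hxy.le hP
    calc |(∑' k, b k * F (x - fun i => (k i : ℝ))) - ∑' k, b k * F (y - fun i => (k i : ℝ))|
        ≤ 2 * (N * (L * E * B)) * 1 + L * ∑ i, |x i - y i| := by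
          rw [abs_le]
          constructor <;> linarith [hx.1, hx.2, hy.1, hy.2, hg.1, hg.2]
      _ ≤ 2 * (N * (L * E * B)) * (∑ i, |x i - y i|) + L * ∑ i, |x i - y i| := by linarith
      _ = (2 * (N * (E * B)) + 1) * L * ∑ i, |x i - y i| := by ring
      _ ≤ _ := by
        gcongr
        exact le_max_right _ _

end Quasiprojection

/-- A scale function with unit integral and the reproducing property is a partition of unity. -/
lemma tsum_translates_eq_one {φ : ℝ → ℝ} {R : ℕ} (hφ : Integrable φ)
    (hsupp : ∀ t, φ t ≠ 0 → |t| ≤ R) (hint : ∫ x, φ x = 1)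
    (hrepro : ∀ y : ℝ, ∫ z : ℝ, ∑' l : ℤ, φ (y - l) * φ (z - l) = 1) (y : ℝ) :
    ∑' l : ℤ, φ (y - l) = 1 := by
  have hzero : ∀ l ∉ Finset.Icc ⌈y - R⌉ ⌊y + R⌋, φ (y - (l : ℤ)) = 0 := fun l hl => by
    by_contra h
    exact hl (mem_Icc_ceil_floor.2 (hsupp _ h))
  rw [← hrepro y, tsum_eq_sum hzero]
  have hfin : ∀ z : ℝ, ∑' l : ℤ, φ (y - l) * φ (z - l) =
      ∑ l ∈ Finset.Icc ⌈y - R⌉ ⌊y + R⌋, φ (y - l) * φ (z - l) := fun z =>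
    tsum_eq_sum fun l hl => by rw [hzero l hl, zero_mul]
  simp_rw [hfin]
  rw [integral_finsetSum _ fun (l : ℤ) _ => (hφ.comp_sub_right (l : ℝ)).const_mul (φ (y - l))]
  refine Finset.sum_congr rfl fun l _ => ?_
  rw [integral_const_mul, integral_sub_right_eq_self φ, hint, mul_one]

/-- A tensor product of compactly supported partitions of unity is a partition of unity. -/
lemma tsum_prod_translates_eq_one {d : ℕ} {φ : ℝ → ℝ} {R : ℕ}
    (hsupp : ∀ t, φ t ≠ 0 → |t| ≤ R) (hone : ∀ y : ℝ, ∑' l : ℤ, φ (y - l) = 1)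
    (x : Fin d → ℝ) : ∑' k : Fin d → ℤ, ∏ i, φ (x i - k i) = 1 := by
  rw [tsum_eq_sum (s := latticeBox x R) fun k hk => ?_]
  · rw [latticeBox, ← Finset.prod_univ_sum
      (fun i => Finset.Icc ⌈x i - R⌉ ⌊x i + R⌋) fun i (l : ℤ) => φ (x i - l)]
    refine Finset.prod_eq_one fun i _ => ?_
    rw [← hone (x i), tsum_eq_sum fun l hl => ?_]
    by_contra h
    exact hl (mem_Icc_ceil_floor.2 (hsupp _ h))
  · by_contra h
    exact hk (mem_latticeBox.2 fun i => hsupp _ (Finset.prod_ne_zero_iff.1 h i (Finset.mem_univ i)))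

/-- Uniform-in-scale Lipschitz continuity of wavelet projections: if `φ` is a Lipschitz,
compactly supported scale function with `∫ φ = 1` and the reproducing property, and `g`
is bounded and Lipschitz, then the projections `g_j` of `g` onto the spans of the
tensor-product scale functions `Φ_{j,k}` are Lipschitz with a constant independent of
the scale `j`. -/
theorem wavelet_projection_uniform_lipschitz
    (d : ℕ) (φ : ℝ → ℝ) (Lφ : NNReal) (hφLip : LipschitzWith Lφ φ)
    (hφsupp : HasCompactSupport φ)
    (hφint : ∫ x : ℝ, φ x = 1)
    (hφrepro : ∀ y : ℝ, ∫ z : ℝ, ∑' l : ℤ, φ (y - l) * φ (z - l) = 1)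
    (Φ : ℤ → (Fin d → ℤ) → (Fin d → ℝ) → ℝ)
    (hΦ : ∀ j k x, Φ j k x =
      (2 : ℝ) ^ (((j : ℝ) * d) / 2) * ∏ i, φ ((2 : ℝ) ^ j * x i - k i))
    (g : (Fin d → ℝ) → ℝ)
    (Lg : ℝ) (hgLip : ∀ x y, |g x - g y| ≤ Lg * ∑ i, |x i - y i|)
    (Cg : ℝ) (hgb : ∀ x, |g x| ≤ Cg)
    (α : ℤ → (Fin d → ℤ) → ℝ)
    (hα : ∀ j k, α j k = ∫ x : Fin d → ℝ, g x * Φ j k x)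
    (gj : ℤ → (Fin d → ℝ) → ℝ)
    (hgj : ∀ j x, gj j x = ∑' k : Fin d → ℤ, α j k * Φ j k x) :
    ∃ C : ℝ, ∀ (j : ℤ) (x y : Fin d → ℝ),
      |gj j x - gj j y| ≤ C * ∑ i, |x i - y i| := by
  obtain ⟨R₀, hR₀⟩ := hφsupp.isCompact.isBounded.exists_norm_le
  obtain ⟨R, hR⟩ := exists_nat_ge R₀
  have hsupp : ∀ t, φ t ≠ 0 → |t| ≤ R := fun t ht =>
    (hR₀ t (subset_tsupport φ ht)).trans hR
  obtain ⟨M₀, hM₀⟩ := hφLip.continuous.bounded_above_of_compact_support hφsupp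
  obtain ⟨M, hM1, hM⟩ : ∃ M : ℝ, 1 ≤ M ∧ ∀ t, |φ t| ≤ M :=
    ⟨max 1 M₀, le_max_left _ _, fun t => (hM₀ t).trans (le_max_right _ _)⟩
  have hone := tsum_translates_eq_one
    (hφLip.continuous.integrable_of_hasCompactSupport hφsupp) hsupp hφint hφrepro
  set F : (Fin d → ℝ) → ℝ := fun x => ∏ i, φ (x i) with hF
  have hFlip : ∀ x y, |F x - F y| ≤ M ^ d * Lφ * ∑ i, |x i - y i| := fun x y => by
    refine (abs_prod_sub_prod_le Finset.univ _ _ hM1 (fun i => hM (x i))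
      fun i => hM (y i)).trans ?_
    rw [Finset.card_univ, Fintype.card_fin, mul_assoc, Finset.mul_sum Finset.univ _ (Lφ : ℝ)]
    gcongr with i
    exact hφLip.dist_le_mul (x i) (y i)
  have hFB : ∀ x, |F x| ≤ M ^ d := fun x => by
    rw [hF, Finset.abs_prod]
    exact (Finset.prod_le_prod (fun _ _ => abs_nonneg _) fun i _ => hM _).trans_eq (by simp)
  have hFint : ∫ x, F x = 1 := by
    rw [hF, integral_fintype_prod_volume_eq_prod fun _ => φ]
    simp [hφint]
  obtain ⟨C, hC⟩ := exists_lipschitz_quasiprojection hFlip hFB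
    (fun x hx i => hsupp _ (Finset.prod_ne_zero_iff.1 hx i (Finset.mem_univ i))) hFint
    (tsum_prod_translates_eq_one hsupp hone)
  refine ⟨C * |Lg|, fun j x y => ?_⟩
  set s : ℝ := (2 : ℝ) ^ j with hs
  have hs0 : 0 < s := by positivity
  set c : ℝ := (2 : ℝ) ^ (((j : ℝ) * d) / 2) with hc
  have hcc : c * c = s ^ d := by
    rw [hc, ← Real.rpow_add two_pos, add_halves, Real.rpow_mul two_pos.le, Real.rpow_intCast,
      Real.rpow_natCast]
  set G : (Fin d → ℝ) → ℝ := fun v => g (s⁻¹ • v) with hG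
  have hGlip : ∀ x y, |G x - G y| ≤ |Lg| * s⁻¹ * ∑ i, |x i - y i| := fun x y => by
    refine (hgLip _ _).trans ?_
    have h : ∑ i, |(s⁻¹ • x) i - (s⁻¹ • y) i| = s⁻¹ * ∑ i, |x i - y i| := by
      simp only [Pi.smul_apply, smul_eq_mul, ← mul_sub, abs_mul, abs_of_pos (inv_pos.2 hs0),
        Finset.mul_sum]
    rw [h, mul_assoc]
    gcongr
    exact le_abs_self Lg
  have hΦF : ∀ k u, Φ j k u = c * F (s • u - fun i => (k i : ℝ)) := fun k u => hΦ j k u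
  have hterm : ∀ k u, α j k * Φ j k u =
      (∫ v, G v * F (v - fun i => (k i : ℝ))) * F (s • u - fun i => (k i : ℝ)) := fun k u => by
    have hint : ∫ u, g u * Φ j k u = c * ∫ u, G (s • u) * F (s • u - fun i => (k i : ℝ)) := by
      rw [← integral_const_mul]
      refine integral_congr_ae (Filter.Eventually.of_forall fun u => ?_)
      simp only [hΦF, hG, inv_smul_smul₀ hs0.ne']
      ring
    rw [hα, hint, hΦF, Measure.integral_comp_smul volume
      (fun v => G v * F (v - fun i => (k i : ℝ))) s, Module.finrank_fin_fun, smul_eq_mul,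
      abs_of_pos (by positivity), ← hcc]
    have hc0 : c ≠ 0 := by positivity
    field_simp
  have hscale : ∑ i, |(s • x) i - (s • y) i| = s * ∑ i, |x i - y i| := by
    simp only [Pi.smul_apply, smul_eq_mul, ← mul_sub, abs_mul, abs_of_pos hs0, Finset.mul_sum]
  have key := hC G (|Lg| * s⁻¹) (by positivity) hGlip (s • x) (s • y)
  rw [hscale] at key
  simp_rw [hgj, hterm]
  refine key.trans_eq ?_
  field_simp
end

section
/- Kernel truncation for degenerate U-statistics of weakly dependent data: Let (X_n)_{n∈ℕ} be a strictly stationary sequence of ℝ^d-valued random variables with common distribution P_X and E‖X_1‖_{l1} < ∞. Suppose there are coefficients (τ_r)_{r∈ℕ} with Σ_{r=1}^∞ r·τ_r^δ < ∞ for some δ ∈ (0,1) such that for all u ∈ ℕ and all indices s_1 ≤ ⋯ ≤ s_u < s_u + r ≤ t_1 ≤ t_2 ≤ t_3 in ℕ there exists a random vector (X̃_{t_1}', X̃_{t_2}', X̃_{t_3}')' with the same distribution as (X_{t_1}', X_{t_2}', X_{t_3}')', independent of (X_{s_1}, …, X_{s_u}), satisfying Σ_{i=1}^3 E‖X̃_{t_i}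 − X_{t_i}‖_{l1} ≤ τ_r. Let h : ℝ^d × ℝ^d → ℝ be a symmetric, Lipschitz continuous kernel that is degenerate under P_X, i.e., ∫ h(x,y) P_X(dx) = 0 for all y ∈ ℝ^d, and assume sup_{k∈ℕ} E|h(X_1, X_{1+k})|^ν < ∞ and E|h(X_1, X̃_1)|^ν < ∞ for some ν > (2−δ)/(1−δ), where X̃_1 is an independent copy of X_1. For c > 0 set c_h = max_{x,y∈[−c,c]^d} |h(x,y)|, let h̃^{(c)} be h truncated at ±c_h (h̃^{(c)}(x,y) = h(x,y) if |h(x,y)| ≤ c_h, = c_h if h(x,y) > c_h, = −c_h if h(x,y) < −c_h), and let h_c(x,y) = h̃^{(c)}(x,y) − ∫ h̃^{(c)}(x,y) P_X(dx) − ∫ h̃^{(c)}(x,y) P_X(dy) + ∬ h̃^{(c)}(x,y) P_X(dx) P_X(dy) be its degenerate version. Define U_n = n^{-2} Σ_{j=1}^n Σ_{k≠j} h(X_j, X_k) and U_{n,c} = n^{-2} Σ_{j=1}^n Σ_{k≠j} h_c(X_j, X_k). Then lim_{c→∞} sup_{n∈ℕ} n² E(U_n − U_{n,c})² = 0. -/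
open MeasureTheory ProbabilityTheory
open scoped ENNReal

theorem sum_dist_le_two_mul_tsum {b : ℕ → ℝ} (hb : ∀ r, 0 ≤ b r) (hs : Summable b) (p : ℕ)
    (s : Finset ℕ) : ∑ q ∈ s, b (p - q + (q - p)) ≤ 2 * ∑' r, b r := by
  have key : ∀ t : Finset ℕ, Set.InjOn (fun q => p - q + (q - p)) (t : Set ℕ) →
      ∑ q ∈ t, b (p - q + (q - p)) ≤ ∑' r, b r := by
    intro t ht
    rw [← Finset.sum_image (f := b) (g := fun q => p - q + (q - p)) ht]
    exact hs.sum_le_tsum _ fun r _ => hb r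
  rw [← Finset.sum_filter_add_sum_filter_not s (· ≤ p), two_mul]
  refine add_le_add (key _ ?_) (key _ ?_)
  · intro q hq q' hq' h
    simp only [Finset.coe_filter, Set.mem_ofPred_eq] at hq hq' h
    omega
  · intro q hq q' hq' h
    simp only [Finset.coe_filter, Set.mem_ofPred_eq] at hq hq' h
    omega

theorem card_filter_dist_le (u r : ℕ) (s : Finset ℕ) :
    (s.filter fun v => u - v + (v - u) ≤ r).card ≤ 2 * r + 1 := by
  calc (s.filter fun v => u - v + (v - u) ≤ r).card ≤ (Finset.Icc (u - r) (u + r)).card := by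
        refine Finset.card_le_card fun v hv => ?_
        simp only [Finset.mem_filter, Finset.mem_Icc] at hv ⊢
        omega
    _ ≤ 2 * r + 1 := by
        rw [Nat.card_Icc]
        omega

theorem sum_max_dist_le {a : ℕ → ℝ} (ha : ∀ r, 0 ≤ a r)
    (hs : Summable fun r : ℕ => (2 * (r : ℝ) + 1) * a r) (s : Finset ℕ) :
    ∑ p ∈ s, ∑ q ∈ s, ∑ u ∈ s, ∑ v ∈ s, a (max (p - q + (q - p)) (u - v + (v - u)))
      ≤ 4 * (s.card : ℝ) ^ 2 * ∑' r : ℕ, (2 * (r : ℝ) + 1) * a r := by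
  set b : ℕ → ℝ := fun r => (2 * (r : ℝ) + 1) * a r with hb
  have hb0 : ∀ r, 0 ≤ b r := fun r => mul_nonneg (by positivity) (ha r)
  have hcount : ∀ u r, ∑ v ∈ s, (if u - v + (v - u) ≤ r then a r else 0) ≤ b r := by
    intro u r
    rw [← Finset.sum_filter, Finset.sum_const, nsmul_eq_mul]
    refine mul_le_mul_of_nonneg_right ?_ (ha r)
    exact_mod_cast card_filter_dist_le u r s
  have hpt : ∀ x y : ℕ, a (max x y) ≤ (if y ≤ x then a x else 0) + (if x ≤ y then a y else 0) := by
    intro x y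
    rcases le_total x y with h | h
    · rw [max_eq_right h, if_pos h]
      have : 0 ≤ (if y ≤ x then a x else 0) := by split_ifs <;> simp [ha]
      linarith
    · rw [max_eq_left h, if_pos h]
      have : 0 ≤ (if x ≤ y then a y else 0) := by split_ifs <;> simp [ha]
      linarith
  have hinner : ∀ p u, ∑ q ∈ s, ∑ v ∈ s, a (max (p - q + (q - p)) (u - v + (v - u)))
      ≤ 4 * ∑' r, b r := by
    intro p u
    calc ∑ q ∈ s, ∑ v ∈ s, a (max (p - q + (q - p)) (u - v + (v - u)))
        ≤ ∑ q ∈ s, ∑ v ∈ s,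
            ((if u - v + (v - u) ≤ p - q + (q - p) then a (p - q + (q - p)) else 0)
              + (if p - q + (q - p) ≤ u - v + (v - u) then a (u - v + (v - u)) else 0)) :=
          Finset.sum_le_sum fun q _ => Finset.sum_le_sum fun v _ => hpt _ _
      _ = ∑ q ∈ s, ∑ v ∈ s,
            (if u - v + (v - u) ≤ p - q + (q - p) then a (p - q + (q - p)) else 0)
          + ∑ v ∈ s, ∑ q ∈ s,
            (if p - q + (q - p) ≤ u - v + (v - u) then a (u - v + (v - u)) else 0) := by
          simp only [Finset.sum_add_distrib]
          congr 1
          exact Finset.sum_comm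
      _ ≤ ∑ q ∈ s, b (p - q + (q - p)) + ∑ v ∈ s, b (u - v + (v - u)) :=
          add_le_add (Finset.sum_le_sum fun q _ => hcount _ _)
            (Finset.sum_le_sum fun v _ => hcount _ _)
      _ ≤ 4 * ∑' r, b r := by
          have h1 := sum_dist_le_two_mul_tsum hb0 hs p s
          have h2 := sum_dist_le_two_mul_tsum hb0 hs u s
          linarith
  calc ∑ p ∈ s, ∑ q ∈ s, ∑ u ∈ s, ∑ v ∈ s, a (max (p - q + (q - p)) (u - v + (v - u)))
      = ∑ p ∈ s, ∑ u ∈ s, ∑ q ∈ s, ∑ v ∈ s, a (max (p - q + (q - p)) (u - v + (v - u))) :=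
        Finset.sum_congr rfl fun p _ => Finset.sum_comm
    _ ≤ ∑ p ∈ s, ∑ u ∈ s, 4 * ∑' r, b r :=
        Finset.sum_le_sum fun p _ => Finset.sum_le_sum fun u _ => hinner p u
    _ = 4 * (s.card : ℝ) ^ 2 * ∑' r, b r := by
        simp only [Finset.sum_const, nsmul_eq_mul]
        ring

theorem le_add_add_of_gap {F : ℕ → ℕ → ℕ → ℕ → ℝ} {a : ℕ → ℝ} (ha : ∀ r, 0 ≤ a r)
    (hswap₁ : ∀ j k l m, F j k l m = F k j l m) (hswap₂ : ∀ j k l m, F j k l m = F j k m l)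
    (hswap : ∀ j k l m, F j k l m = F l m j k)
    (hdiag : ∀ j k l m, j ≠ k → l ≠ m → F j k l m ≤ a 0)
    (hgap : ∀ j k l m r, j ≠ k → l ≠ m → 1 ≤ r →
      (j + r ≤ k ∧ j + r ≤ l ∧ j + r ≤ m ∨ k + r ≤ j ∧ l + r ≤ j ∧ m + r ≤ j) →
      F j k l m ≤ a r)
    (j k l m : ℕ) (hjk : j ≠ k) (hlm : l ≠ m) :
    F j k l m ≤ a (max (j - k + (k - j)) (l - m + (m - l)))
      + a (max (j - l + (l - j)) (k - m + (m - k)))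
      + a (max (j - m + (m - j)) (k - l + (l - k))) := by
  have extreme : ∀ (f : ℝ) (x u v z ρ : ℕ), x ≤ u → u ≤ v → v ≤ z →
      ρ = max (u - x) (z - v) → f ≤ a 0 →
      (∀ r, 1 ≤ r → x + r ≤ u → f ≤ a r) → (∀ r, 1 ≤ r → v + r ≤ z → f ≤ a r) → f ≤ a ρ := by
    intro f x u v z ρ hxu huv hvz hρ h0 h1 h2
    rcases Nat.eq_zero_or_pos ρ with h | h
    · rwa [h]
    · rcases le_total (z - v) (u - x) with h' | h'
      · exact h1 _ h (by omega)
      · exact h2 _ h (by omega)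
  have hmin_last : ∀ j k l m, j ≠ k → l ≠ m → j ≤ k → j ≤ l → k ≤ m → l ≤ m →
      F j k l m ≤ a (max (j - k + (k - j)) (l - m + (m - l)))
        + a (max (j - l + (l - j)) (k - m + (m - k))) := by
    intro j k l m hjk hlm h1 h2 h3 h4
    have hF : F j k l m = F m l j k := by rw [hswap, hswap₁]
    rcases le_total k l with h | h
    · refine le_add_of_le_of_nonneg ?_ (ha _)
      refine extreme _ j k l m _ h1 h h4 (by omega) (hdiag _ _ _ _ hjk hlm)
        (fun r hr hr' => hgap _ _ _ _ _ hjk hlm hr (Or.inl (by omega))) fun r hr hr' => ?_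
      rw [hF]
      exact hgap _ _ _ _ _ hlm.symm hjk hr (Or.inr (by omega))
    · refine le_add_of_nonneg_of_le (ha _) ?_
      refine extreme _ j l k m _ h2 h h3 (by omega) (hdiag _ _ _ _ hjk hlm)
        (fun r hr hr' => hgap _ _ _ _ _ hjk hlm hr (Or.inl (by omega))) fun r hr hr' => ?_
      rw [hF]
      exact hgap _ _ _ _ _ hlm.symm hjk hr (Or.inr (by omega))
  have hmin_second : ∀ j k l m, j ≠ k → l ≠ m → j ≤ l → j ≤ m → l ≤ k → m ≤ k →
      F j k l m ≤ a (max (j - l + (l - j)) (k - m + (m - k)))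
        + a (max (j - m + (m - j)) (k - l + (l - k))) := by
    intro j k l m hjk hlm h1 h2 h3 h4
    rcases le_total l m with h | h
    · refine le_add_of_le_of_nonneg ?_ (ha _)
      refine extreme _ j l m k _ h1 h h4 (by omega) (hdiag _ _ _ _ hjk hlm)
        (fun r hr hr' => hgap _ _ _ _ _ hjk hlm hr (Or.inl (by omega))) fun r hr hr' => ?_
      rw [hswap₁]
      exact hgap _ _ _ _ _ hjk.symm hlm hr (Or.inr (by omega))
    · refine le_add_of_nonneg_of_le (ha _) ?_
      refine extreme _ j m l k _ h2 h h3 (by omega) (hdiag _ _ _ _ hjk hlm)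
        (fun r hr hr' => hgap _ _ _ _ _ hjk hlm hr (Or.inl (by omega))) fun r hr hr' => ?_
      rw [hswap₁]
      exact hgap _ _ _ _ _ hjk.symm hlm hr (Or.inr (by omega))
  have hmin : ∀ j k l m, j ≠ k → l ≠ m → j ≤ k → j ≤ l → j ≤ m →
      F j k l m ≤ a (max (j - k + (k - j)) (l - m + (m - l)))
        + a (max (j - l + (l - j)) (k - m + (m - k)))
        + a (max (j - m + (m - j)) (k - l + (l - k))) := by
    intro j k l m hjk hlm h1 h2 h3
    have p1 := ha (max (j - k + (k - j)) (l - m + (m - l)))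
    have p2 := ha (max (j - l + (l - j)) (k - m + (m - k)))
    have p3 := ha (max (j - m + (m - j)) (k - l + (l - k)))
    by_cases hk : l ≤ k ∧ m ≤ k
    · linarith [hmin_second j k l m hjk hlm h2 h3 hk.1 hk.2]
    · rcases le_total l m with h | h
      · linarith [hmin_last j k l m hjk hlm h1 h2 (by omega) h]
      · have := hmin_last j k m l hjk hlm.symm h1 h3 (by omega) h
        rw [← hswap₂, Nat.add_comm (m - l) (l - m)] at this
        linarith
  have hmin_left : ∀ j k l m, j ≠ k → l ≠ m → (j ≤ l ∧ j ≤ m ∨ k ≤ l ∧ k ≤ m) →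
      F j k l m ≤ a (max (j - k + (k - j)) (l - m + (m - l)))
        + a (max (j - l + (l - j)) (k - m + (m - k)))
        + a (max (j - m + (m - j)) (k - l + (l - k))) := by
    intro j k l m hjk hlm h
    by_cases hj : j ≤ k ∧ j ≤ l ∧ j ≤ m
    · exact hmin j k l m hjk hlm hj.1 hj.2.1 hj.2.2
    · have := hmin k j l m hjk.symm hlm (by omega) (by omega) (by omega)
      rw [← hswap₁, Nat.add_comm (k - j) (j - k), max_comm (k - l + (l - k)),
        max_comm (k - m + (m - k))] at this
      linarith
  by_cases h : j ≤ l ∧ j ≤ m ∨ k ≤ l ∧ k ≤ m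
  · exact hmin_left j k l m hjk hlm h
  · have := hmin_left l m j k hlm hjk (by omega)
    rw [← hswap, max_comm (l - m + (m - l)), Nat.add_comm (l - j), Nat.add_comm (m - k),
      max_comm (l - k + (k - l)), Nat.add_comm (l - k), Nat.add_comm (m - j)] at this
    exact this

theorem sum_sum_erase_le {F : ℕ → ℕ → ℕ → ℕ → ℝ} {a : ℕ → ℝ} (ha : ∀ r, 0 ≤ a r)
    (hs : Summable fun r : ℕ => (2 * (r : ℝ) + 1) * a r)
    (hF : ∀ j k l m, j ≠ k → l ≠ m →
      F j k l m ≤ a (max (j - k + (k - j)) (l - m + (m - l)))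
        + a (max (j - l + (l - j)) (k - m + (m - k)))
        + a (max (j - m + (m - j)) (k - l + (l - k)))) (s : Finset ℕ) :
    ∑ j ∈ s, ∑ k ∈ s.erase j, ∑ l ∈ s, ∑ m ∈ s.erase l, F j k l m
      ≤ 12 * (s.card : ℝ) ^ 2 * ∑' r : ℕ, (2 * (r : ℝ) + 1) * a r := by
  set R : ℕ → ℕ → ℕ → ℕ → ℝ := fun j k l m => a (max (j - k + (k - j)) (l - m + (m - l)))
        + a (max (j - l + (l - j)) (k - m + (m - k)))
        + a (max (j - m + (m - j)) (k - l + (l - k))) with hR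
  have hR0 : ∀ j k l m, 0 ≤ R j k l m := fun j k l m =>
    add_nonneg (add_nonneg (ha _) (ha _)) (ha _)
  have hcount := sum_max_dist_le ha hs s
  calc ∑ j ∈ s, ∑ k ∈ s.erase j, ∑ l ∈ s, ∑ m ∈ s.erase l, F j k l m
      ≤ ∑ j ∈ s, ∑ k ∈ s.erase j, ∑ l ∈ s, ∑ m ∈ s.erase l, R j k l m :=
        Finset.sum_le_sum fun j _ => Finset.sum_le_sum fun k hk => Finset.sum_le_sum fun l _ =>
          Finset.sum_le_sum fun m hm =>
            hF j k l m (Finset.ne_of_mem_erase hk).symm (Finset.ne_of_mem_erase hm).symm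
    _ ≤ ∑ j ∈ s, ∑ k ∈ s, ∑ l ∈ s, ∑ m ∈ s, R j k l m := by
        refine Finset.sum_le_sum fun j _ => ?_
        refine le_trans (Finset.sum_le_sum fun k _ => Finset.sum_le_sum fun l _ =>
          Finset.sum_le_sum_of_subset_of_nonneg (Finset.erase_subset l s)
            fun m _ _ => hR0 j k l m) ?_
        exact Finset.sum_le_sum_of_subset_of_nonneg (Finset.erase_subset j s) fun k _ _ =>
          Finset.sum_nonneg fun l _ => Finset.sum_nonneg fun m _ => hR0 j k l m
    _ = ∑ j ∈ s, ∑ k ∈ s, ∑ l ∈ s, ∑ m ∈ s, a (max (j - k + (k - j)) (l - m + (m - l)))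
        + ∑ j ∈ s, ∑ l ∈ s, ∑ k ∈ s, ∑ m ∈ s, a (max (j - l + (l - j)) (k - m + (m - k)))
        + ∑ j ∈ s, ∑ m ∈ s, ∑ k ∈ s, ∑ l ∈ s, a (max (j - m + (m - j)) (k - l + (l - k))) := by
        simp only [hR, Finset.sum_add_distrib]
        congr 1
        · congr 1
          exact Finset.sum_congr rfl fun j _ => Finset.sum_comm
        · refine Finset.sum_congr rfl fun j _ => ?_
          conv_rhs => rw [Finset.sum_comm]
          exact Finset.sum_congr rfl fun k _ => Finset.sum_comm
    _ ≤ 12 * (s.card : ℝ) ^ 2 * ∑' r : ℕ, (2 * (r : ℝ) + 1) * a r := by linarith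

theorem ENNReal.mul_rpow_le_rpow_add_rpow (a b : ℝ≥0∞) {q : ℝ} (hq : 0 ≤ q) :
    a * b ^ q ≤ a ^ (1 + q) + b ^ (1 + q) := by
  have hpow : ∀ x : ℝ≥0∞, x * x ^ q = x ^ (1 + q) := fun x => by
    rw [ENNReal.rpow_add_of_nonneg _ _ zero_le_one hq, ENNReal.rpow_one]
  rcases le_total a b with h | h
  · calc a * b ^ q ≤ b * b ^ q := by gcongr
      _ = b ^ (1 + q) := hpow b
      _ ≤ _ := le_add_self
  · calc a * b ^ q ≤ a * a ^ q := by gcongr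
      _ = a ^ (1 + q) := hpow a
      _ ≤ _ := le_self_add

theorem ENNReal.rpow_le_mul_add_mul_rpow (a K : ℝ≥0∞) (hK : K ≠ 0) (hK' : K ≠ ∞) {p ν : ℝ}
    (hp : 1 ≤ p) (hpν : p ≤ ν) : a ^ p ≤ K ^ (p - 1) * a + K ^ (p - ν) * a ^ ν := by
  rcases le_total a K with h | h
  · calc a ^ p = a ^ (p - 1) * a := by
          conv_rhs => rw [← ENNReal.rpow_one a, ← ENNReal.rpow_mul, one_mul,
            ← ENNReal.rpow_add_of_nonneg _ _ (sub_nonneg.2 hp) zero_le_one]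
          congr 1
          ring
      _ ≤ K ^ (p - 1) * a := by
          gcongr
      _ ≤ _ := le_self_add
  · calc a ^ p = K ^ (p - ν) * (K ^ (ν - p) * a ^ p) := by
          rw [← mul_assoc, ← ENNReal.rpow_add _ _ hK hK']
          simp
      _ ≤ K ^ (p - ν) * (a ^ (ν - p) * a ^ p) := by
          gcongr
      _ = K ^ (p - ν) * a ^ ν := by
          rw [← ENNReal.rpow_add_of_nonneg _ _ (sub_nonneg.2 hpν) (by linarith)]
          congr 2
          ring
      _ ≤ _ := le_add_self

theorem ENNReal.rpow_add_add_add_le (a b c d : ℝ≥0∞) {ν : ℝ} (hν : 0 ≤ ν) :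
    (a + b + c + d) ^ ν ≤ 4 ^ ν * (a ^ ν + b ^ ν + c ^ ν + d ^ ν) := by
  set m := max (max a b) (max c d) with hm
  have hle : a + b + c + d ≤ 4 * m := by
    calc a + b + c + d ≤ m + m + m + m := by
          gcongr <;> simp [hm]
      _ = 4 * m := by ring
  have hmp : m ^ ν ≤ a ^ ν + b ^ ν + c ^ ν + d ^ ν := by
    have hcases : m = a ∨ m = b ∨ m = c ∨ m = d := by
      rcases max_choice (max a b) (max c d) with h | h <;> rw [hm, h]
      · rcases max_choice a b with h | h <;> rw [h] <;> simp
      · rcases max_choice c d with h | h <;> rw [h] <;> simp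
    rcases hcases with h | h | h | h <;> rw [h]
    · exact le_self_add.trans (le_self_add.trans le_self_add)
    · exact le_add_self.trans (le_self_add.trans le_self_add)
    · exact le_add_self.trans le_self_add
    · exact le_add_self
  calc (a + b + c + d) ^ ν ≤ (4 * m) ^ ν := ENNReal.rpow_le_rpow hle hν
    _ = 4 ^ ν * m ^ ν := ENNReal.mul_rpow_of_nonneg _ _ hν
    _ ≤ _ := by gcongr

theorem lintegral_mul_le_rpow_mul_rpow {α : Type*} [MeasurableSpace α] {P : Measure α}
    {D W : α → ℝ≥0∞} (hD : Measurable D) (hW : Measurable W) {δ : ℝ} (hδ : 0 < δ) (hδ1 : δ < 1) :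
    ∫⁻ ω, D ω * W ω ∂P
      ≤ (∫⁻ ω, D ω ∂P) ^ δ * (∫⁻ ω, D ω * W ω ^ (1 - δ)⁻¹ ∂P) ^ (1 - δ) := by
  have h1 : 0 < 1 - δ := sub_pos.2 hδ1
  calc ∫⁻ ω, D ω * W ω ∂P = ∫⁻ ω, D ω ^ δ * (D ω * W ω ^ (1 - δ)⁻¹) ^ (1 - δ) ∂P := by
        refine lintegral_congr fun ω => ?_
        rw [ENNReal.mul_rpow_of_nonneg _ _ h1.le, ← ENNReal.rpow_mul, inv_mul_cancel₀ h1.ne',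
          ENNReal.rpow_one, ← mul_assoc, ← ENNReal.rpow_add_of_nonneg _ _ hδ.le h1.le]
        simp
    _ ≤ _ := ENNReal.lintegral_mul_norm_pow_le hD.aemeasurable
        (hD.mul (hW.pow_const _)).aemeasurable hδ.le h1.le (by ring)

theorem rpow_lintegral_le_lintegral_rpow {α : Type*} [MeasurableSpace α] {P : Measure α}
    [IsProbabilityMeasure P] {f : α → ℝ≥0∞} (hf : Measurable f) {ν : ℝ} (hν : 1 ≤ ν) :
    (∫⁻ ω, f ω ∂P) ^ ν ≤ ∫⁻ ω, f ω ^ ν ∂P := by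
  have h0 : 0 < ν := by linarith
  have h := ENNReal.lintegral_mul_norm_pow_le (μ := P) (f := fun ω => f ω ^ ν)
    (g := fun _ => 1) (hf.pow_const ν).aemeasurable aemeasurable_const
    (inv_nonneg.2 h0.le) (sub_nonneg.2 (inv_le_one_of_one_le₀ hν)) (by ring)
  simp only [← ENNReal.rpow_mul, mul_inv_cancel₀ h0.ne', ENNReal.rpow_one, ENNReal.one_rpow,
    mul_one, lintegral_one, measure_univ] at h
  calc (∫⁻ ω, f ω ∂P) ^ ν ≤ ((∫⁻ ω, f ω ^ ν ∂P) ^ ν⁻¹) ^ ν := ENNReal.rpow_le_rpow h h0.le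
    _ = _ := by rw [← ENNReal.rpow_mul, inv_mul_cancel₀ h0.ne', ENNReal.rpow_one]

/-- The `ℓ¹` norm on `ℝ^d`. -/
noncomputable def l1norm {d : ℕ} (x : Fin d → ℝ) : ℝ := ∑ i, |x i|

theorem l1norm_nonneg {d : ℕ} (x : Fin d → ℝ) : 0 ≤ l1norm x :=
  Finset.sum_nonneg fun _ _ => abs_nonneg _

@[simp]
theorem l1norm_zero {d : ℕ} : l1norm (0 : Fin d → ℝ) = 0 := by simp [l1norm]

theorem continuous_l1norm {d : ℕ} : Continuous (l1norm (d := d)) := by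
  unfold l1norm
  fun_prop

@[fun_prop]
theorem measurable_l1norm {d : ℕ} : Measurable (l1norm (d := d)) :=
  continuous_l1norm.measurable

theorem l1norm_sub_le {d : ℕ} (x y : Fin d → ℝ) : l1norm (x - y) ≤ l1norm x + l1norm y := by
  unfold l1norm
  rw [← Finset.sum_add_distrib]
  exact Finset.sum_le_sum fun i _ => abs_sub _ _

/-- A kernel on `ℝ^d × ℝ^d` is Lipschitz with constant `L` with respect to the `ℓ¹` norm. -/
def IsL1Lipschitz {d : ℕ} (L : ℝ) (e : (Fin d → ℝ) → (Fin d → ℝ) → ℝ) : Prop :=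
  ∀ x x' y y', |e x y - e x' y'| ≤ L * (l1norm (x - x') + l1norm (y - y'))

namespace IsL1Lipschitz

variable {d : ℕ} {L : ℝ} {e : (Fin d → ℝ) → (Fin d → ℝ) → ℝ}

theorem continuous_uncurry (he : IsL1Lipschitz L e) :
    Continuous fun z : (Fin d → ℝ) × (Fin d → ℝ) => e z.1 z.2 := by
  rw [continuous_iff_continuousAt]
  intro z₀
  rw [ContinuousAt, tendsto_iff_norm_sub_tendsto_zero]
  refine squeeze_zero (fun _ => norm_nonneg _) (fun z => he z.1 z₀.1 z.2 z₀.2) ?_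
  have hcont : Continuous fun z : (Fin d → ℝ) × (Fin d → ℝ) =>
      L * (l1norm (z.1 - z₀.1) + l1norm (z.2 - z₀.2)) :=
    ((continuous_l1norm.comp (by fun_prop)).add
      (continuous_l1norm.comp (by fun_prop))).const_mul _
  simpa using hcont.tendsto z₀

theorem measurable_uncurry (he : IsL1Lipschitz L e) :
    Measurable fun z : (Fin d → ℝ) × (Fin d → ℝ) => e z.1 z.2 :=
  he.continuous_uncurry.measurable

theorem measurable_comp (he : IsL1Lipschitz L e) {α : Type*} [MeasurableSpace α]
    {Y Z : α → Fin d → ℝ} (hY : Measurable Y) (hZ : Measurable Z) :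
    Measurable fun ω => e (Y ω) (Z ω) :=
  he.measurable_uncurry.comp (hY.prodMk hZ)

theorem integrable_left (he : IsL1Lipschitz L e) {μ : Measure (Fin d → ℝ)}
    [IsProbabilityMeasure μ] (hμ : Integrable l1norm μ) (y : Fin d → ℝ) :
    Integrable (fun x => e x y) μ := by
  refine ((hμ.const_mul L).add (integrable_const |e 0 y|)).mono'
    (he.measurable_comp measurable_id measurable_const).aestronglyMeasurable
    (Filter.Eventually.of_forall fun x => ?_)
  have h1 := he x 0 y y
  have h2 := abs_sub_abs_le_abs_sub (e x y) (e 0 y)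
  simp only [sub_zero, sub_self, l1norm_zero, add_zero] at h1
  simp only [Real.norm_eq_abs, Pi.add_apply]
  linarith

theorem swap (he : IsL1Lipschitz L e) : IsL1Lipschitz L fun x y => e y x := fun x x' y y' => by
  rw [add_comm]
  exact he y y' x x'

theorem abs_integral_left_sub_le (he : IsL1Lipschitz L e) {μ : Measure (Fin d → ℝ)}
    [IsProbabilityMeasure μ] (hμ : Integrable l1norm μ) (y y' : Fin d → ℝ) :
    |∫ x, e x y ∂μ - ∫ x, e x y' ∂μ| ≤ L * l1norm (y - y') := by
  rw [← integral_sub (he.integrable_left hμ y) (he.integrable_left hμ y')]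
  have h := norm_integral_le_of_norm_le_const (μ := μ) (f := fun x => e x y - e x y')
    (C := L * l1norm (y - y')) (Filter.Eventually.of_forall fun x => by
      have := he x x y y'
      simpa using this)
  simpa using h

end IsL1Lipschitz

/-- The degenerate (doubly centred) version of a kernel with respect to `μ`. -/
noncomputable def degenerateVersion {E : Type*} [MeasurableSpace E] (μ : Measure E)
    (e : E → E → ℝ) (x y : E) : ℝ :=
  e x y - ∫ x', e x' y ∂μ - ∫ y', e x y' ∂μ + ∫ x', ∫ y', e x' y' ∂μ ∂μ

theorem degenerateVersion_symm {E : Type*} [MeasurableSpace E] (μ : Measure E)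
    {e : E → E → ℝ} (hsymm : ∀ x y, e x y = e y x) (x y : E) :
    degenerateVersion μ e x y = degenerateVersion μ e y x := by
  have h1 : ∫ x', e x' y ∂μ = ∫ y', e y y' ∂μ :=
    integral_congr_ae (ae_of_all _ fun z => hsymm z y)
  have h2 : ∫ y', e x y' ∂μ = ∫ x', e x' x ∂μ :=
    integral_congr_ae (ae_of_all _ fun z => hsymm x z)
  simp only [degenerateVersion, hsymm x y, h1, h2]
  ring

namespace IsL1Lipschitz

variable {d : ℕ} {L : ℝ} {e : (Fin d → ℝ) → (Fin d → ℝ) → ℝ}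

theorem degenerateVersion (he : IsL1Lipschitz L e) {μ : Measure (Fin d → ℝ)}
    [IsProbabilityMeasure μ] (hμ : Integrable l1norm μ) :
    IsL1Lipschitz (2 * L) (degenerateVersion μ e) := by
  intro x x' y y'
  have h1 := abs_le.1 (he x x' y y')
  have h2 := abs_le.1 (he.abs_integral_left_sub_le hμ y y')
  have h3 := abs_le.1 (he.swap.abs_integral_left_sub_le hμ x x')
  simp only [_root_.degenerateVersion]
  rw [abs_le]
  constructor <;> linarith [h1.1, h1.2, h2.1, h2.2, h3.1, h3.2]

theorem integral_degenerateVersion (he : IsL1Lipschitz L e) {μ : Measure (Fin d → ℝ)}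
    [IsProbabilityMeasure μ] (hμ : Integrable l1norm μ) (y : Fin d → ℝ) :
    ∫ x, _root_.degenerateVersion μ e x y ∂μ = 0 := by
  have hi : Integrable (fun x => ∫ y', e x y' ∂μ) μ := by
    have hL : IsL1Lipschitz L fun x (_ : Fin d → ℝ) => ∫ y', e x y' ∂μ := by
      intro x x' y y'
      refine (he.swap.abs_integral_left_sub_le hμ x x').trans ?_
      have h0 := he x x' y y
      have h1 := (abs_nonneg _).trans (he x x y y')
      simp only [sub_self, l1norm_zero, zero_add] at h1
      linarith
    exact hL.integrable_left hμ 0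
  have he' := he.integrable_left hμ y
  simp only [_root_.degenerateVersion]
  rw [integral_add (by fun_prop) (by fun_prop), integral_sub (by fun_prop) hi,
    integral_sub he' (by fun_prop)]
  simp

end IsL1Lipschitz

theorem enorm_degenerateVersion_le {E : Type*} [MeasurableSpace E] (μ : Measure E)
    {e : E → E → ℝ} (hsymm : ∀ x y, e x y = e y x) (x y : E) :
    ‖degenerateVersion μ e x y‖ₑ ≤ ‖e x y‖ₑ + ∫⁻ x', ‖e x' y‖ₑ ∂μ + ∫⁻ x', ‖e x' x‖ₑ ∂μ
      + ∫⁻ y', ∫⁻ x', ‖e x' y'‖ₑ ∂μ ∂μ := by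
  have hle : ∀ z, ‖∫ y', e z y' ∂μ‖ₑ ≤ ∫⁻ x', ‖e x' z‖ₑ ∂μ := fun z => by
    refine (enorm_integral_le_lintegral_enorm _).trans_eq ?_
    simp_rw [hsymm z]
  refine (enorm_add_le _ _).trans (add_le_add ((enorm_sub_le).trans
    (add_le_add ((enorm_sub_le).trans (add_le_add le_rfl ?_)) (hle x))) ?_)
  · exact enorm_integral_le_lintegral_enorm _
  · exact (enorm_integral_le_lintegral_enorm _).trans (lintegral_mono hle)

/-- Pair distributions with both marginals equal to `μ` and a controlled moment of a kernel. -/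
structure IsAdmissiblePair {E : Type*} [MeasurableSpace E] (μ : Measure E) (h : E → E → ℝ)
    (ν : ℝ) (C : ℝ≥0∞) (Q : Measure (E × E)) : Prop where
  map_fst : Q.map Prod.fst = μ
  map_snd : Q.map Prod.snd = μ
  lintegral_le : ∫⁻ z, ‖h z.1 z.2‖ₑ ^ ν ∂Q ≤ C

theorem tendsto_lintegral_indicator_l1norm {d : ℕ} {μ : Measure (Fin d → ℝ)}
    (hμ : Integrable l1norm μ) :
    Filter.Tendsto (fun c : ℝ => ∫⁻ x, {x : Fin d → ℝ | ∀ i, |x i| ≤ c}ᶜ.indicator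
      (fun x => ‖l1norm x‖ₑ) x ∂μ) Filter.atTop (nhds 0) := by
  have hmeas : ∀ c : ℝ, MeasurableSet {x : Fin d → ℝ | ∀ i, |x i| ≤ c} := fun c => by
    rw [Set.ofPred_forall]
    exact MeasurableSet.iInter fun i => measurableSet_le (by fun_prop) measurable_const
  have h := tendsto_lintegral_filter_of_dominated_convergence (μ := μ) (l := Filter.atTop)
    (F := fun (c : ℝ) x => {x : Fin d → ℝ | ∀ i, |x i| ≤ c}ᶜ.indicator (fun x => ‖l1norm x‖ₑ) x)
    (f := fun _ => 0) (fun x => ‖l1norm x‖ₑ)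
    (Filter.Eventually.of_forall fun c => (measurable_l1norm.enorm).indicator (hmeas c).compl)
    (Filter.Eventually.of_forall fun c => ae_of_all _ fun x => Set.indicator_le_self _ _ _)
    hμ.2.ne
    (ae_of_all _ fun x => by
      refine tendsto_const_nhds.congr' ?_
      filter_upwards [Filter.eventually_ge_atTop (l1norm x)] with c hc
      rw [Set.indicator_of_notMem]
      simp only [Set.mem_compl_iff, not_not]
      intro i
      exact (Finset.single_le_sum (f := fun i => |x i|) (fun _ _ => abs_nonneg _)
        (Finset.mem_univ i)).trans hc)
  simpa using h

theorem IsL1Lipschitz.enorm_le_indicator {d : ℕ} {L : ℝ} {e : (Fin d → ℝ) → (Fin d → ℝ) → ℝ}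
    (hL : 0 ≤ L) (he : IsL1Lipschitz L e) {c : ℝ} (hc : 0 ≤ c)
    (hzero : ∀ x y, (∀ i, |x i| ≤ c) → (∀ i, |y i| ≤ c) → e x y = 0) (x y : Fin d → ℝ) :
    ‖e x y‖ₑ ≤ ENNReal.ofReal L *
      ({x : Fin d → ℝ | ∀ i, |x i| ≤ c}ᶜ.indicator (fun x => ‖l1norm x‖ₑ) x
        + {x : Fin d → ℝ | ∀ i, |x i| ≤ c}ᶜ.indicator (fun x => ‖l1norm x‖ₑ) y) := by
  classical
  set B : Set (Fin d → ℝ) := {x | ∀ i, |x i| ≤ c} with hB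
  have hproj : ∀ x : Fin d → ℝ, ∃ x' ∈ B, ENNReal.ofReal (l1norm (x - x'))
      ≤ Bᶜ.indicator (fun x => ‖l1norm x‖ₑ) x := by
    intro x
    by_cases hx : x ∈ B
    · exact ⟨x, hx, by simp⟩
    · refine ⟨0, fun i => by simpa using hc, ?_⟩
      rw [Set.indicator_of_mem (by simpa using hx), sub_zero, ← ofReal_norm,
        Real.norm_of_nonneg (l1norm_nonneg x)]
  obtain ⟨x', hx', hxx'⟩ := hproj x
  obtain ⟨y', hy', hyy'⟩ := hproj y
  have h1 := he x x' y y'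
  rw [hzero x' y' hx' hy', sub_zero] at h1
  calc ‖e x y‖ₑ = ENNReal.ofReal |e x y| := (ofReal_norm _).symm
    _ ≤ ENNReal.ofReal (L * (l1norm (x - x') + l1norm (y - y'))) := ENNReal.ofReal_le_ofReal h1
    _ = ENNReal.ofReal L *
          (ENNReal.ofReal (l1norm (x - x')) + ENNReal.ofReal (l1norm (y - y'))) := by
        rw [ENNReal.ofReal_mul hL, ENNReal.ofReal_add (l1norm_nonneg _) (l1norm_nonneg _)]
    _ ≤ _ := by gcongr

theorem exists_forall_lintegral_degenerateVersion_le {d : ℕ} {μ : Measure (Fin d → ℝ)}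
    [IsProbabilityMeasure μ] (hμ : Integrable l1norm μ) {L : ℝ} (hL : 0 ≤ L)
    {h : (Fin d → ℝ) → (Fin d → ℝ) → ℝ} {e : ℝ → (Fin d → ℝ) → (Fin d → ℝ) → ℝ}
    (he : ∀ c, 0 < c → IsL1Lipschitz L (e c)) (hsymm : ∀ c x y, e c x y = e c y x)
    (hle : ∀ c, 0 < c → ∀ x y, |e c x y| ≤ |h x y|)
    (hzero : ∀ c, 0 < c → ∀ x y, (∀ i, |x i| ≤ c) → (∀ i, |y i| ≤ c) → e c x y = 0)
    {ν : ℝ} {C : ℝ≥0∞} (hC : C ≠ ∞) (hprod : ∫⁻ y, ∫⁻ x, ‖h x y‖ₑ ^ ν ∂μ ∂μ ≤ C)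
    {p : ℝ} (hp : 1 ≤ p) (hpν : p < ν) {η : ℝ≥0∞} (hη : η ≠ 0) :
    ∃ c₀ > 0, ∀ c ≥ c₀, ∀ Q : Measure ((Fin d → ℝ) × (Fin d → ℝ)),
      IsAdmissiblePair μ h ν C Q →
        ∫⁻ z, ‖degenerateVersion μ (e c) z.1 z.2‖ₑ ^ p ∂Q ≤ η := by
  have hν0 : 0 ≤ ν := by linarith
  set W : ℝ → (Fin d → ℝ) → ℝ≥0∞ := fun c => {x : Fin d → ℝ | ∀ i, |x i| ≤ c}ᶜ.indicator
    (fun x => ‖l1norm x‖ₑ) with hW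
  have hWm : ∀ c, Measurable (W c) := fun c => by
    refine measurable_l1norm.enorm.indicator (MeasurableSet.compl ?_)
    rw [Set.ofPred_forall]
    exact MeasurableSet.iInter fun i => measurableSet_le (by fun_prop) measurable_const
  set m : ℝ → ℝ≥0∞ := fun c => ∫⁻ x, W c x ∂μ with hm
  have hfirst : ∀ c, 0 < c → ∀ Q, IsAdmissiblePair μ h ν C Q →
      ∫⁻ z, ‖degenerateVersion μ (e c) z.1 z.2‖ₑ ∂Q ≤ 8 * ENNReal.ofReal L * m c
      ∧ ∫⁻ z, ‖degenerateVersion μ (e c) z.1 z.2‖ₑ ^ ν ∂Q ≤ 4 ^ ν * (4 * C) := by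
    intro c hc Q hQ
    have hem := (he c hc).measurable_uncurry.enorm
    set φ : (Fin d → ℝ) → ℝ≥0∞ := fun y => ∫⁻ x, ‖e c x y‖ₑ ∂μ with hφ
    have hφm : Measurable φ := hem.lintegral_prod_left'
    have hfst : ∀ f : (Fin d → ℝ) → ℝ≥0∞, Measurable f → ∫⁻ z, f z.1 ∂Q = ∫⁻ x, f x ∂μ :=
      fun f hf => by rw [← hQ.map_fst, lintegral_map hf measurable_fst]
    have hsnd : ∀ f : (Fin d → ℝ) → ℝ≥0∞, Measurable f → ∫⁻ z, f z.2 ∂Q = ∫⁻ x, f x ∂μ :=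
      fun f hf => by rw [← hQ.map_snd, lintegral_map hf measurable_snd]
    have hQ1 : Q Set.univ = 1 := by
      have := congrArg (fun m => m Set.univ) hQ.map_fst
      simpa [Measure.map_apply measurable_fst MeasurableSet.univ] using this
    have hpt : ∀ z : (Fin d → ℝ) × (Fin d → ℝ), ‖degenerateVersion μ (e c) z.1 z.2‖ₑ
        ≤ ‖e c z.1 z.2‖ₑ + φ z.2 + φ z.1 + ∫⁻ y, φ y ∂μ :=
      fun z => enorm_degenerateVersion_le μ (hsymm c) z.1 z.2
    have hebd := (he c hc).enorm_le_indicator hL hc.le (hzero c hc)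
    have w1 : Measurable fun z : (Fin d → ℝ) × (Fin d → ℝ) => W c z.1 := (hWm c).comp measurable_fst
    have w2 : Measurable fun z : (Fin d → ℝ) × (Fin d → ℝ) => W c z.2 := (hWm c).comp measurable_snd
    have φ1 : Measurable fun z : (Fin d → ℝ) × (Fin d → ℝ) => φ z.1 := hφm.comp measurable_fst
    have φ2 : Measurable fun z : (Fin d → ℝ) × (Fin d → ℝ) => φ z.2 := hφm.comp measurable_snd
    constructor
    · have h1 : ∫⁻ z, ‖e c z.1 z.2‖ₑ ∂Q ≤ ENNReal.ofReal L * (m c + m c) := by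
        calc ∫⁻ z, ‖e c z.1 z.2‖ₑ ∂Q
            ≤ ∫⁻ z, ENNReal.ofReal L * (W c z.1 + W c z.2) ∂Q :=
              lintegral_mono fun z => hebd z.1 z.2
          _ = _ := by
              rw [lintegral_const_mul _ (by fun_prop), lintegral_add_left w1, hfst _ (hWm c),
                hsnd _ (hWm c)]
      have h2 : ∫⁻ y, φ y ∂μ ≤ ENNReal.ofReal L * (m c + m c) := by
        calc ∫⁻ y, φ y ∂μ
            ≤ ∫⁻ y, ∫⁻ x, ENNReal.ofReal L * (W c x + W c y) ∂μ ∂μ :=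
              lintegral_mono fun y => lintegral_mono fun x => hebd x y
          _ = _ := by
              have : ∀ y, ∫⁻ x, ENNReal.ofReal L * (W c x + W c y) ∂μ
                  = ENNReal.ofReal L * (m c + W c y) := fun y => by
                rw [lintegral_const_mul _ ((hWm c).add_const _), lintegral_add_left (hWm c)]
                simp [hm]
              simp_rw [this]
              rw [lintegral_const_mul _ ((hWm c).const_add _), lintegral_add_right _ (hWm c)]
              simp [hm]
      calc ∫⁻ z, ‖degenerateVersion μ (e c) z.1 z.2‖ₑ ∂Q
          ≤ ∫⁻ z, (‖e c z.1 z.2‖ₑ + φ z.2 + φ z.1 + ∫⁻ y, φ y ∂μ) ∂Q := lintegral_mono hpt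
        _ = ∫⁻ z, ‖e c z.1 z.2‖ₑ ∂Q + ∫⁻ y, φ y ∂μ + ∫⁻ y, φ y ∂μ + ∫⁻ y, φ y ∂μ := by
            rw [lintegral_add_right _ measurable_const,
              lintegral_add_right _ φ1, lintegral_add_right _ φ2, hfst _ hφm, hsnd _ hφm]
            simp [hQ1]
        _ ≤ ENNReal.ofReal L * (m c + m c) + ENNReal.ofReal L * (m c + m c)
            + ENNReal.ofReal L * (m c + m c) + ENNReal.ofReal L * (m c + m c) := by gcongr
        _ = 8 * ENNReal.ofReal L * m c := by ring
    · have habs : ∀ x y, ‖e c x y‖ₑ ^ ν ≤ ‖h x y‖ₑ ^ ν := fun x y => by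
        refine ENNReal.rpow_le_rpow ?_ hν0
        rw [enorm_le_iff_norm_le]
        exact hle c hc x y
      have h1 : ∫⁻ z, ‖e c z.1 z.2‖ₑ ^ ν ∂Q ≤ C :=
        (lintegral_mono fun z : (Fin d → ℝ) × (Fin d → ℝ) => habs z.1 z.2).trans hQ.lintegral_le
      have h2 : ∫⁻ y, φ y ^ ν ∂μ ≤ C := by
        refine le_trans (lintegral_mono fun y => ?_) hprod
        refine (rpow_lintegral_le_lintegral_rpow (hem.comp measurable_prodMk_right)
          (hp.trans hpν.le)).trans ?_
        exact lintegral_mono fun x => habs x y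
      have h3 : (∫⁻ y, φ y ∂μ) ^ ν ≤ C :=
        (rpow_lintegral_le_lintegral_rpow hφm (hp.trans hpν.le)).trans h2
      calc ∫⁻ z, ‖degenerateVersion μ (e c) z.1 z.2‖ₑ ^ ν ∂Q
          ≤ ∫⁻ z, 4 ^ ν * (‖e c z.1 z.2‖ₑ ^ ν + φ z.2 ^ ν + φ z.1 ^ ν
              + (∫⁻ y, φ y ∂μ) ^ ν) ∂Q :=
            lintegral_mono fun z => (ENNReal.rpow_le_rpow (hpt z) hν0).trans
              (ENNReal.rpow_add_add_add_le _ _ _ _ hν0)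
        _ = 4 ^ ν * (∫⁻ z, ‖e c z.1 z.2‖ₑ ^ ν ∂Q + ∫⁻ y, φ y ^ ν ∂μ + ∫⁻ y, φ y ^ ν ∂μ
              + (∫⁻ y, φ y ∂μ) ^ ν) := by
            rw [lintegral_const_mul _ (by fun_prop),
              lintegral_add_right _ measurable_const, lintegral_add_right _ (φ1.pow_const ν),
              lintegral_add_right _ (φ2.pow_const ν), hfst _ (hφm.pow_const ν),
              hsnd _ (hφm.pow_const ν)]
            simp [hQ1]
        _ ≤ 4 ^ ν * (C + C + C + C) := by gcongr
        _ = 4 ^ ν * (4 * C) := by ring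
  set B : ℝ≥0∞ := 4 ^ ν * (4 * C) with hB
  have hBtop : B ≠ ∞ :=
    ENNReal.mul_ne_top (ENNReal.rpow_ne_top_of_nonneg hν0 (by simp))
      (ENNReal.mul_ne_top (by simp) hC)
  have hη2 : η / 2 ≠ 0 := (ENNReal.div_pos hη (by simp)).ne'
  set η' : ℝ≥0∞ := min 1 (η / 2 / B) with hη'
  have hη'0 : η' ≠ 0 := by
    have : 0 < η / 2 / B := ENNReal.div_pos hη2 hBtop
    exact (lt_min one_pos this).ne'
  have hη't : η' ≠ ∞ := ne_top_of_le_ne_top ENNReal.one_ne_top (min_le_left _ _)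
  set K : ℝ≥0∞ := η' ^ (p - ν)⁻¹ with hK
  have hK0 : K ≠ 0 := by simp [hK, ENNReal.rpow_eq_zero_iff, hη'0, hη't]
  have hKt : K ≠ ∞ := by simp [hK, ENNReal.rpow_eq_top_iff, hη'0, hη't]
  have hKpow : K ^ (p - ν) = η' := by
    rw [hK, ← ENNReal.rpow_mul, inv_mul_cancel₀ (by linarith : p - ν < 0).ne, ENNReal.rpow_one]
  have hKB : K ^ (p - ν) * B ≤ η / 2 := by
    rw [hKpow, mul_comm]
    exact (mul_le_mul_right (min_le_right _ _) B).trans ENNReal.mul_div_le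
  have hlim : Filter.Tendsto (fun c => K ^ (p - 1) * (8 * ENNReal.ofReal L * m c)) Filter.atTop
      (nhds 0) := by
    have h1 := ENNReal.Tendsto.const_mul (a := 8 * ENNReal.ofReal L)
      (tendsto_lintegral_indicator_l1norm hμ) (Or.inr (ENNReal.mul_ne_top (by simp) (by simp)))
    have h2 := ENNReal.Tendsto.const_mul (a := K ^ (p - 1)) h1
      (Or.inr (ENNReal.rpow_ne_top_of_nonneg (sub_nonneg.2 hp) hKt))
    simpa using h2
  obtain ⟨c₀, hc₀⟩ := Filter.eventually_atTop.1
    ((hlim.eventually (gt_mem_nhds (pos_iff_ne_zero.2 hη2))).and (Filter.eventually_gt_atTop 0))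
  refine ⟨c₀, (hc₀ c₀ le_rfl).2, fun c hc Q hQ => ?_⟩
  obtain ⟨hsmall, hcpos⟩ := hc₀ c hc
  obtain ⟨hint1, hintν⟩ := hfirst c hcpos Q hQ
  have hgm := ((he c hcpos).degenerateVersion hμ).measurable_uncurry.enorm
  calc ∫⁻ z, ‖degenerateVersion μ (e c) z.1 z.2‖ₑ ^ p ∂Q
      ≤ ∫⁻ z, (K ^ (p - 1) * ‖degenerateVersion μ (e c) z.1 z.2‖ₑ
          + K ^ (p - ν) * ‖degenerateVersion μ (e c) z.1 z.2‖ₑ ^ ν) ∂Q :=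
        lintegral_mono fun z => ENNReal.rpow_le_mul_add_mul_rpow _ K hK0 hKt hp hpν.le
    _ = K ^ (p - 1) * ∫⁻ z, ‖degenerateVersion μ (e c) z.1 z.2‖ₑ ∂Q
        + K ^ (p - ν) * ∫⁻ z, ‖degenerateVersion μ (e c) z.1 z.2‖ₑ ^ ν ∂Q := by
        rw [lintegral_add_left (hgm.const_mul _), lintegral_const_mul _ hgm,
          lintegral_const_mul _ (hgm.pow_const ν)]
    _ ≤ K ^ (p - 1) * (8 * ENNReal.ofReal L * m c) + K ^ (p - ν) * B := by gcongr
    _ ≤ η / 2 + η / 2 := add_le_add hsmall.le hKB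
    _ = η := ENNReal.add_halves η

theorem integral_mul_eq_zero_of_indepFun {d : ℕ} {Ω : Type*} [MeasurableSpace Ω] {P : Measure Ω}
    [IsProbabilityMeasure P] {μ : Measure (Fin d → ℝ)} {L : ℝ}
    {g : (Fin d → ℝ) → (Fin d → ℝ) → ℝ} (hg : IsL1Lipschitz L g)
    (hdeg : ∀ y, ∫ x, g x y ∂μ = 0) {Y Z₁ Z₂ Z₃ : Ω → Fin d → ℝ} (hY : Measurable Y)
    (hZ₁ : Measurable Z₁) (hZ₂ : Measurable Z₂) (hZ₃ : Measurable Z₃) (hYμ : P.map Y = μ)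
    (hind : IndepFun Y (fun ω => (Z₁ ω, Z₂ ω, Z₃ ω)) P) :
    ∫ ω, g (Y ω) (Z₁ ω) * g (Z₂ ω) (Z₃ ω) ∂P = 0 := by
  have hZ := hZ₁.prodMk (hZ₂.prodMk hZ₃)
  have hlaw := (indepFun_iff_map_prod_eq_prod_map_map hY.aemeasurable hZ.aemeasurable).1 hind
  have : IsProbabilityMeasure (P.map Y) := Measure.isProbabilityMeasure_map hY.aemeasurable
  have : IsProbabilityMeasure (P.map fun ω => (Z₁ ω, Z₂ ω, Z₃ ω)) :=
    Measure.isProbabilityMeasure_map hZ.aemeasurable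
  set F : (Fin d → ℝ) × ((Fin d → ℝ) × (Fin d → ℝ) × (Fin d → ℝ)) → ℝ :=
    fun w => g w.1 w.2.1 * g w.2.2.1 w.2.2.2 with hF
  have hFm : Measurable F :=
    (hg.measurable_comp (by fun_prop) (by fun_prop)).mul
      (hg.measurable_comp (by fun_prop) (by fun_prop))
  have h1 : ∫ ω, g (Y ω) (Z₁ ω) * g (Z₂ ω) (Z₃ ω) ∂P
      = ∫ w, F w ∂((P.map Y).prod (P.map fun ω => (Z₁ ω, Z₂ ω, Z₃ ω))) := by
    rw [← hlaw, integral_map (hY.prodMk hZ).aemeasurable hFm.aestronglyMeasurable]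
  rw [h1]
  by_cases hint : Integrable F ((P.map Y).prod (P.map fun ω => (Z₁ ω, Z₂ ω, Z₃ ω)))
  · rw [integral_prod_symm _ hint]
    simp [hF, integral_mul_const, hYμ, hdeg]
  · exact integral_undef hint

theorem lintegral_enorm_sub_mul_le {Ω : Type*} [MeasurableSpace Ω] {P : Measure Ω}
    {A A' B : Ω → ℝ} (hA : Measurable A) (hA' : Measurable A') (hB : Measurable B)
    {δ : ℝ} (hδ : 0 < δ) (hδ1 : δ < 1) {η t : ℝ≥0∞}
    (hAη : ∫⁻ ω, ‖A ω‖ₑ ^ (1 + (1 - δ)⁻¹) ∂P ≤ η)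
    (hA'η : ∫⁻ ω, ‖A' ω‖ₑ ^ (1 + (1 - δ)⁻¹) ∂P ≤ η)
    (hBη : ∫⁻ ω, ‖B ω‖ₑ ^ (1 + (1 - δ)⁻¹) ∂P ≤ η)
    (ht : ∫⁻ ω, ‖A ω - A' ω‖ₑ ∂P ≤ t) :
    ∫⁻ ω, ‖A ω - A' ω‖ₑ * ‖B ω‖ₑ ∂P ≤ t ^ δ * (4 * η) ^ (1 - δ) := by
  have h1 : 0 < 1 - δ := sub_pos.2 hδ1
  have hq : 0 ≤ (1 - δ)⁻¹ := (inv_pos.2 h1).le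
  refine (lintegral_mul_le_rpow_mul_rpow (hA.sub hA').enorm hB.enorm hδ hδ1).trans ?_
  refine mul_le_mul' (ENNReal.rpow_le_rpow ht hδ.le) (ENNReal.rpow_le_rpow ?_ h1.le)
  have mA := hA.enorm.pow_const (1 + (1 - δ)⁻¹)
  have mA' := hA'.enorm.pow_const (1 + (1 - δ)⁻¹)
  have mB := hB.enorm.pow_const (1 + (1 - δ)⁻¹)
  calc ∫⁻ ω, ‖A ω - A' ω‖ₑ * ‖B ω‖ₑ ^ (1 - δ)⁻¹ ∂P
      ≤ ∫⁻ ω, ((‖A ω‖ₑ ^ (1 + (1 - δ)⁻¹) + ‖B ω‖ₑ ^ (1 + (1 - δ)⁻¹))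
          + (‖A' ω‖ₑ ^ (1 + (1 - δ)⁻¹) + ‖B ω‖ₑ ^ (1 + (1 - δ)⁻¹))) ∂P := by
        refine lintegral_mono fun ω => ?_
        calc ‖A ω - A' ω‖ₑ * ‖B ω‖ₑ ^ (1 - δ)⁻¹
            ≤ (‖A ω‖ₑ + ‖A' ω‖ₑ) * ‖B ω‖ₑ ^ (1 - δ)⁻¹ := by gcongr; exact enorm_sub_le
          _ ≤ _ := by
              rw [add_mul]
              exact add_le_add (ENNReal.mul_rpow_le_rpow_add_rpow _ _ hq)
                (ENNReal.mul_rpow_le_rpow_add_rpow _ _ hq)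
    _ = ∫⁻ ω, ‖A ω‖ₑ ^ (1 + (1 - δ)⁻¹) ∂P + ∫⁻ ω, ‖B ω‖ₑ ^ (1 + (1 - δ)⁻¹) ∂P
        + (∫⁻ ω, ‖A' ω‖ₑ ^ (1 + (1 - δ)⁻¹) ∂P + ∫⁻ ω, ‖B ω‖ₑ ^ (1 + (1 - δ)⁻¹) ∂P) := by
        rw [lintegral_add_left (by fun_prop), lintegral_add_left mA, lintegral_add_left mA']
    _ ≤ η + η + (η + η) := by gcongr
    _ = 4 * η := by ring

theorem enorm_integral_mul_le_of_coupling {d : ℕ} {Ω : Type*} [MeasurableSpace Ω] {P : Measure Ω}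
    [IsProbabilityMeasure P] {μ : Measure (Fin d → ℝ)} {L : ℝ} (hL : 0 ≤ L)
    {g : (Fin d → ℝ) → (Fin d → ℝ) → ℝ} (hg : IsL1Lipschitz L g)
    (hdeg : ∀ y, ∫ x, g x y ∂μ = 0) {δ : ℝ} (hδ : 0 < δ) (hδ1 : δ < 1)
    {Y Z₁ Z₂ Z₃ Y' Z₁' Z₂' Z₃' : Ω → Fin d → ℝ} (hY : Measurable Y)
    (hZ₁ : Measurable Z₁) (hZ₂ : Measurable Z₂) (hZ₃ : Measurable Z₃) (hY' : Measurable Y')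
    (hZ₁' : Measurable Z₁') (hZ₂' : Measurable Z₂') (hZ₃' : Measurable Z₃')
    (hYμ : P.map Y' = μ) (hind : IndepFun Y' (fun ω => (Z₁' ω, Z₂' ω, Z₃' ω)) P)
    {η t : ℝ≥0∞}
    (ht₁ : ∫⁻ ω, ENNReal.ofReal (l1norm (Y ω - Y' ω) + l1norm (Z₁ ω - Z₁' ω)) ∂P ≤ t)
    (ht₂ : ∫⁻ ω, ENNReal.ofReal (l1norm (Z₂ ω - Z₂' ω) + l1norm (Z₃ ω - Z₃' ω)) ∂P ≤ t)
    {G : Set (Measure ((Fin d → ℝ) × (Fin d → ℝ)))}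
    (hGp : ∀ Q ∈ G, ∫⁻ z, ‖g z.1 z.2‖ₑ ^ (1 + (1 - δ)⁻¹) ∂Q ≤ η)
    (hG2 : ∀ Q ∈ G, MemLp (fun z => g z.1 z.2) 2 Q)
    (hA : P.map (fun ω => (Y ω, Z₁ ω)) ∈ G) (hB : P.map (fun ω => (Z₂ ω, Z₃ ω)) ∈ G)
    (hA' : P.map (fun ω => (Y' ω, Z₁' ω)) ∈ G) (hB' : P.map (fun ω => (Z₂' ω, Z₃' ω)) ∈ G) :
    ‖∫ ω, g (Y ω) (Z₁ ω) * g (Z₂ ω) (Z₃ ω) ∂P‖ₑ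
      ≤ 2 * ((ENNReal.ofReal L * t) ^ δ * (4 * η) ^ (1 - δ)) := by
  have hp : ∀ {V W : Ω → Fin d → ℝ}, Measurable V → Measurable W →
      P.map (fun ω => (V ω, W ω)) ∈ G → ∫⁻ ω, ‖g (V ω) (W ω)‖ₑ ^ (1 + (1 - δ)⁻¹) ∂P ≤ η := by
    intro V W hV hW hVW
    refine le_trans (le_of_eq ?_) (hGp _ hVW)
    rw [lintegral_map (hg.measurable_uncurry.enorm.pow_const _) (hV.prodMk hW)]
  have h2 : ∀ {V W : Ω → Fin d → ℝ}, Measurable V → Measurable W →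
      P.map (fun ω => (V ω, W ω)) ∈ G → MemLp (fun ω => g (V ω) (W ω)) 2 P :=
    fun hV hW hVW => (hG2 _ hVW).comp_of_map (hV.prodMk hW).aemeasurable
  have hdiff : ∀ {V W V' W' : Ω → Fin d → ℝ},
      ∫⁻ ω, ENNReal.ofReal (l1norm (V ω - V' ω) + l1norm (W ω - W' ω)) ∂P ≤ t →
      ∫⁻ ω, ‖g (V ω) (W ω) - g (V' ω) (W' ω)‖ₑ ∂P ≤ ENNReal.ofReal L * t := by
    intro V W V' W' h
    calc ∫⁻ ω, ‖g (V ω) (W ω) - g (V' ω) (W' ω)‖ₑ ∂P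
        ≤ ∫⁻ ω, ENNReal.ofReal L
            * ENNReal.ofReal (l1norm (V ω - V' ω) + l1norm (W ω - W' ω)) ∂P := by
          refine lintegral_mono fun ω => ?_
          rw [← ofReal_norm, ← ENNReal.ofReal_mul hL]
          exact ENNReal.ofReal_le_ofReal (hg _ _ _ _)
      _ = ENNReal.ofReal L
            * ∫⁻ ω, ENNReal.ofReal (l1norm (V ω - V' ω) + l1norm (W ω - W' ω)) ∂P :=
          lintegral_const_mul' _ _ ENNReal.ofReal_ne_top
      _ ≤ _ := by gcongr
  have mA := hg.measurable_comp hY hZ₁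
  have mB := hg.measurable_comp hZ₂ hZ₃
  have mA' := hg.measurable_comp hY' hZ₁'
  have mB' := hg.measurable_comp hZ₂' hZ₃'
  have hi : Integrable (fun ω => g (Y ω) (Z₁ ω) * g (Z₂ ω) (Z₃ ω)) P :=
    (h2 hY hZ₁ hA).integrable_mul (h2 hZ₂ hZ₃ hB)
  have hi' : Integrable (fun ω => g (Y' ω) (Z₁' ω) * g (Z₂' ω) (Z₃' ω)) P :=
    (h2 hY' hZ₁' hA').integrable_mul (h2 hZ₂' hZ₃' hB')
  have hzero := integral_mul_eq_zero_of_indepFun hg hdeg hY' hZ₁' hZ₂' hZ₃' hYμ hind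
  calc ‖∫ ω, g (Y ω) (Z₁ ω) * g (Z₂ ω) (Z₃ ω) ∂P‖ₑ
      = ‖∫ ω, (g (Y ω) (Z₁ ω) * g (Z₂ ω) (Z₃ ω) - g (Y' ω) (Z₁' ω) * g (Z₂' ω) (Z₃' ω)) ∂P‖ₑ := by
        rw [integral_sub hi hi', hzero, sub_zero]
    _ ≤ ∫⁻ ω, ‖g (Y ω) (Z₁ ω) * g (Z₂ ω) (Z₃ ω) - g (Y' ω) (Z₁' ω) * g (Z₂' ω) (Z₃' ω)‖ₑ ∂P :=
        enorm_integral_le_lintegral_enorm _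
    _ ≤ ∫⁻ ω, (‖g (Y ω) (Z₁ ω) - g (Y' ω) (Z₁' ω)‖ₑ * ‖g (Z₂ ω) (Z₃ ω)‖ₑ
          + ‖g (Z₂ ω) (Z₃ ω) - g (Z₂' ω) (Z₃' ω)‖ₑ * ‖g (Y' ω) (Z₁' ω)‖ₑ) ∂P := by
        refine lintegral_mono fun ω => ?_
        rw [← enorm_mul, ← enorm_mul]
        refine le_trans (le_of_eq ?_) (enorm_add_le _ _)
        congr 1
        ring
    _ = ∫⁻ ω, ‖g (Y ω) (Z₁ ω) - g (Y' ω) (Z₁' ω)‖ₑ * ‖g (Z₂ ω) (Z₃ ω)‖ₑ ∂P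
          + ∫⁻ ω, ‖g (Z₂ ω) (Z₃ ω) - g (Z₂' ω) (Z₃' ω)‖ₑ * ‖g (Y' ω) (Z₁' ω)‖ₑ ∂P :=
        lintegral_add_left ((mA.sub mA').enorm.mul mB.enorm) _
    _ ≤ (ENNReal.ofReal L * t) ^ δ * (4 * η) ^ (1 - δ)
          + (ENNReal.ofReal L * t) ^ δ * (4 * η) ^ (1 - δ) :=
        add_le_add
          (lintegral_enorm_sub_mul_le mA mA' mB hδ hδ1 (hp hY hZ₁ hA) (hp hY' hZ₁' hA')
            (hp hZ₂ hZ₃ hB) (hdiff ht₁))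
          (lintegral_enorm_sub_mul_le mB mB' mA' hδ hδ1 (hp hZ₂ hZ₃ hB) (hp hZ₂' hZ₃' hB')
            (hp hY' hZ₁' hA') (hdiff ht₂))
    _ = _ := (two_mul _).symm

/-- There is a copy of the triple `(Y₁, Y₂, Y₃)`, independent of `V` and at mean `ℓ¹` distance at
most `t` from it. -/
def HasCoupling {d : ℕ} {Ω F : Type*} [MeasurableSpace Ω] [MeasurableSpace F] (P : Measure Ω)
    (V : Ω → F) (Y₁ Y₂ Y₃ : Ω → Fin d → ℝ) (t : ℝ) : Prop :=
  ∃ Z₁ Z₂ Z₃ : Ω → Fin d → ℝ, Measurable Z₁ ∧ Measurable Z₂ ∧ Measurable Z₃ ∧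
    P.map (fun ω => (Z₁ ω, Z₂ ω, Z₃ ω)) = P.map (fun ω => (Y₁ ω, Y₂ ω, Y₃ ω)) ∧
    IndepFun V (fun ω => (Z₁ ω, Z₂ ω, Z₃ ω)) P ∧
    ∫ ω, (l1norm (Z₁ ω - Y₁ ω) + l1norm (Z₂ ω - Y₂ ω) + l1norm (Z₃ ω - Y₃ ω)) ∂P ≤ t

namespace HasCoupling

variable {d : ℕ} {Ω F : Type*} [MeasurableSpace Ω] [MeasurableSpace F] {P : Measure Ω}
  {V : Ω → F} {Y₁ Y₂ Y₃ : Ω → Fin d → ℝ} {t : ℝ}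

theorem swap_left (h : HasCoupling P V Y₁ Y₂ Y₃ t) (h₁ : Measurable Y₁) (h₂ : Measurable Y₂)
    (h₃ : Measurable Y₃) : HasCoupling P V Y₂ Y₁ Y₃ t := by
  obtain ⟨Z₁, Z₂, Z₃, m₁, m₂, m₃, hlaw, hind, ht⟩ := h
  have hm : Measurable fun z : (Fin d → ℝ) × (Fin d → ℝ) × (Fin d → ℝ) => (z.2.1, z.1, z.2.2) := by
    fun_prop
  refine ⟨Z₂, Z₁, Z₃, m₂, m₁, m₃, ?_, hind.comp measurable_id hm, ?_⟩
  · have := congrArg (Measure.map fun z : (Fin d → ℝ) × (Fin d → ℝ) × (Fin d → ℝ) =>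
      (z.2.1, z.1, z.2.2)) hlaw
    rwa [Measure.map_map hm (by fun_prop), Measure.map_map hm (by fun_prop)] at this
  · refine le_trans (le_of_eq (integral_congr_ae (ae_of_all _ fun ω => ?_))) ht
    simp only
    ring

theorem swap_right (h : HasCoupling P V Y₁ Y₂ Y₃ t) (h₁ : Measurable Y₁) (h₂ : Measurable Y₂)
    (h₃ : Measurable Y₃) : HasCoupling P V Y₁ Y₃ Y₂ t := by
  obtain ⟨Z₁, Z₂, Z₃, m₁, m₂, m₃, hlaw, hind, ht⟩ := h
  have hm : Measurable fun z : (Fin d → ℝ) × (Fin d → ℝ) × (Fin d → ℝ) => (z.1, z.2.2, z.2.1) := by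
    fun_prop
  refine ⟨Z₁, Z₃, Z₂, m₁, m₃, m₂, ?_, hind.comp measurable_id hm, ?_⟩
  · have := congrArg (Measure.map fun z : (Fin d → ℝ) × (Fin d → ℝ) × (Fin d → ℝ) =>
      (z.1, z.2.2, z.2.1)) hlaw
    rwa [Measure.map_map hm (by fun_prop), Measure.map_map hm (by fun_prop)] at this
  · refine le_trans (le_of_eq (integral_congr_ae (ae_of_all _ fun ω => ?_))) ht
    simp only
    ring

theorem of_sorted {X : ℕ → Ω → Fin d → ℝ} (hX : ∀ n, Measurable (X n)) {T : ℕ}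
    (h : ∀ t₁ t₂ t₃, T ≤ t₁ → t₁ ≤ t₂ → t₂ ≤ t₃ → HasCoupling P V (X t₁) (X t₂) (X t₃) t)
    {k l m : ℕ} (hk : T ≤ k) (hl : T ≤ l) (hm : T ≤ m) :
    HasCoupling P V (X k) (X l) (X m) t := by
  have hfirst : ∀ {k l m : ℕ}, T ≤ k → k ≤ l → k ≤ m → HasCoupling P V (X k) (X l) (X m) t := by
    intro k l m hk hkl hkm
    rcases le_total l m with hlm | hlm
    · exact h k l m hk hkl hlm
    · exact (h k m l hk hkm hlm).swap_right (hX _) (hX _) (hX _)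
  by_cases h₁ : k ≤ l ∧ k ≤ m
  · exact hfirst hk h₁.1 h₁.2
  by_cases h₂ : l ≤ m
  · exact (hfirst hl (by omega) h₂ : HasCoupling P V (X l) (X k) (X m) t).swap_left
      (hX _) (hX _) (hX _)
  · have := (hfirst hm (by omega) (by omega) : HasCoupling P V (X m) (X k) (X l) t)
    exact (this.swap_left (hX _) (hX _) (hX _)).swap_right (hX _) (hX _) (hX _)

end HasCoupling

theorem lintegral_coupling_le {d : ℕ} {Ω : Type*} [MeasurableSpace Ω] {P : Measure Ω}
    {Y₁ Y₂ Y₃ Z₁ Z₂ Z₃ : Ω → Fin d → ℝ} {μ : Measure (Fin d → ℝ)} (hμ : Integrable l1norm μ)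
    (hY₁ : Measurable Y₁) (hY₂ : Measurable Y₂) (hY₃ : Measurable Y₃)
    (hZ₁ : Measurable Z₁) (hZ₂ : Measurable Z₂) (hZ₃ : Measurable Z₃)
    (law₁ : P.map Y₁ = μ) (law₂ : P.map Y₂ = μ) (law₃ : P.map Y₃ = μ)
    (law₁' : P.map Z₁ = μ) (law₂' : P.map Z₂ = μ) (law₃' : P.map Z₃ = μ) {t : ℝ}
    (ht : ∫ ω, (l1norm (Z₁ ω - Y₁ ω) + l1norm (Z₂ ω - Y₂ ω) + l1norm (Z₃ ω - Y₃ ω)) ∂P ≤ t) :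
    ∫⁻ ω, ENNReal.ofReal
      (l1norm (Z₁ ω - Y₁ ω) + l1norm (Z₂ ω - Y₂ ω) + l1norm (Z₃ ω - Y₃ ω)) ∂P
      ≤ ENNReal.ofReal t := by
  have hint : ∀ {Y : Ω → Fin d → ℝ}, Measurable Y → P.map Y = μ →
      Integrable (fun ω => l1norm (Y ω)) P := by
    intro Y hY hlaw
    rw [← hlaw] at hμ
    exact hμ.comp_measurable hY
  have hsub : ∀ {Y Z : Ω → Fin d → ℝ}, Measurable Y → Measurable Z → P.map Y = μ → P.map Z = μ →
      Integrable (fun ω => l1norm (Z ω - Y ω)) P := by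
    intro Y Z hY hZ hYμ hZμ
    refine ((hint hZ hZμ).add (hint hY hYμ)).mono'
      (measurable_l1norm.comp (hZ.sub hY)).aestronglyMeasurable (ae_of_all _ fun ω => ?_)
    rw [Real.norm_of_nonneg (l1norm_nonneg _)]
    exact l1norm_sub_le _ _
  have hsum : Integrable (fun ω =>
      l1norm (Z₁ ω - Y₁ ω) + l1norm (Z₂ ω - Y₂ ω) + l1norm (Z₃ ω - Y₃ ω)) P :=
    ((hsub hY₁ hZ₁ law₁ law₁').add (hsub hY₂ hZ₂ law₂ law₂')).add (hsub hY₃ hZ₃ law₃ law₃')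
  rw [← ofReal_integral_eq_lintegral_ofReal hsum (ae_of_all _ fun ω =>
    add_nonneg (add_nonneg (l1norm_nonneg _) (l1norm_nonneg _)) (l1norm_nonneg _))]
  exact ENNReal.ofReal_le_ofReal ht

theorem l1norm_sub_comm {d : ℕ} (x y : Fin d → ℝ) : l1norm (x - y) = l1norm (y - x) := by
  simp [l1norm, abs_sub_comm]

theorem enorm_integral_mul_le_of_gap {d : ℕ} {Ω : Type*} [MeasurableSpace Ω] {P : Measure Ω}
    [IsProbabilityMeasure P] {X : ℕ → Ω → Fin d → ℝ} (hX : ∀ n, Measurable (X n))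
    {μ : Measure (Fin d → ℝ)} (hμ : Integrable l1norm μ) (hlaw : ∀ n, P.map (X n) = μ)
    {τ : ℕ → ℝ}
    (hcoupling : ∀ (u : ℕ) (s : Fin u → ℕ) (r t₁ t₂ t₃ : ℕ), Monotone s → 1 ≤ r →
      (∀ i, s i + r ≤ t₁) → t₁ ≤ t₂ → t₂ ≤ t₃ →
      HasCoupling P (fun ω (i : Fin u) => X (s i) ω) (X t₁) (X t₂) (X t₃) (τ r))
    {L : ℝ} (hL : 0 ≤ L) {g : (Fin d → ℝ) → (Fin d → ℝ) → ℝ} (hg : IsL1Lipschitz L g)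
    (hdeg : ∀ y, ∫ x, g x y ∂μ = 0) {δ : ℝ} (hδ : 0 < δ) (hδ1 : δ < 1) {η : ℝ≥0∞}
    {G : Set (Measure ((Fin d → ℝ) × (Fin d → ℝ)))}
    (hGp : ∀ Q ∈ G, ∫⁻ z, ‖g z.1 z.2‖ₑ ^ (1 + (1 - δ)⁻¹) ∂Q ≤ η)
    (hG2 : ∀ Q ∈ G, MemLp (fun z => g z.1 z.2) 2 Q)
    (hG : ∀ j k, j ≠ k → P.map (fun ω => (X j ω, X k ω)) ∈ G) (hGprod : μ.prod μ ∈ G)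
    {j k l m r : ℕ} (hjk : j ≠ k) (hlm : l ≠ m) (hr : 1 ≤ r)
    (hgap : j + r ≤ k ∧ j + r ≤ l ∧ j + r ≤ m ∨ k + r ≤ j ∧ l + r ≤ j ∧ m + r ≤ j) :
    ‖∫ ω, g (X j ω) (X k ω) * g (X l ω) (X m ω) ∂P‖ₑ
      ≤ 2 * ((ENNReal.ofReal L * ENNReal.ofReal (τ r)) ^ δ * (4 * η) ^ (1 - δ)) := by
  rcases hgap with ⟨hk, hl, hm⟩ | ⟨hk, hl, hm⟩
  · obtain ⟨Z₁, Z₂, Z₃, m₁, m₂, m₃, hZ, hind, ht⟩ := HasCoupling.of_sorted hX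
      (fun t₁ t₂ t₃ h₁ h₂ h₃ => hcoupling 1 (fun _ => j) r t₁ t₂ t₃ monotone_const hr
        (fun _ => h₁) h₂ h₃) hk hl hm
    replace hind : IndepFun (X j) (fun ω => (Z₁ ω, Z₂ ω, Z₃ ω)) P :=
      hind.comp (measurable_pi_apply 0) measurable_id
    have law₁ : P.map Z₁ = μ := by
      have := congrArg (Measure.map Prod.fst) hZ
      rw [Measure.map_map (by fun_prop) (by fun_prop),
        Measure.map_map (by fun_prop) (by fun_prop)] at this
      exact this.trans (hlaw k)
    have law₂ : P.map Z₂ = μ := by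
      have := congrArg (Measure.map fun z => z.2.1) hZ
      rw [Measure.map_map (by fun_prop) (by fun_prop),
        Measure.map_map (by fun_prop) (by fun_prop)] at this
      exact this.trans (hlaw l)
    have law₃ : P.map Z₃ = μ := by
      have := congrArg (Measure.map fun z => z.2.2) hZ
      rw [Measure.map_map (by fun_prop) (by fun_prop),
        Measure.map_map (by fun_prop) (by fun_prop)] at this
      exact this.trans (hlaw m)
    have law₂₃ : P.map (fun ω => (Z₂ ω, Z₃ ω)) = P.map (fun ω => (X l ω, X m ω)) := by
      have := congrArg (Measure.map Prod.snd) hZ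
      rwa [Measure.map_map (by fun_prop) (by fun_prop),
        Measure.map_map (by fun_prop) (by fun_prop)] at this
    have hdist := lintegral_coupling_le hμ (hX k) (hX l) (hX m) m₁ m₂ m₃ (hlaw k) (hlaw l)
      (hlaw m) law₁ law₂ law₃ ht
    refine enorm_integral_mul_le_of_coupling hL hg hdeg hδ hδ1 (hX j) (hX k) (hX l) (hX m) (hX j)
      m₁ m₂ m₃ (hlaw j) hind (le_trans (lintegral_mono fun ω => ENNReal.ofReal_le_ofReal ?_) hdist)
      (le_trans (lintegral_mono fun ω => ENNReal.ofReal_le_ofReal ?_) hdist) hGp hG2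
      (hG j k hjk) (hG l m hlm) ?_ (law₂₃ ▸ hG l m hlm)
    · rw [sub_self, l1norm_zero, l1norm_sub_comm]
      linarith [l1norm_nonneg (Z₂ ω - X l ω), l1norm_nonneg (Z₃ ω - X m ω)]
    · rw [l1norm_sub_comm, l1norm_sub_comm (X m ω)]
      linarith [l1norm_nonneg (Z₁ ω - X k ω)]
    · have hind₁ : IndepFun (X j) Z₁ P := hind.comp measurable_id measurable_fst
      rw [(indepFun_iff_map_prod_eq_prod_map_map (hX j).aemeasurable m₁.aemeasurable).1 hind₁,
        hlaw, law₁]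
      exact hGprod
  · obtain ⟨Z₁, Z₂, Z₃, m₁, m₂, m₃, hZ, hind, ht⟩ := hcoupling (j - r + 1) (fun i => i) r j j j
      (fun a b hab => hab) hr (fun i => by omega) le_rfl le_rfl
    replace hind : IndepFun Z₁ (fun ω => (X k ω, X l ω, X m ω)) P :=
      (hind.comp (φ := fun v : Fin (j - r + 1) → Fin d → ℝ =>
        (v ⟨k, by omega⟩, v ⟨l, by omega⟩, v ⟨m, by omega⟩)) (by fun_prop) measurable_fst).symm
    have law₁ : P.map Z₁ = μ := by
      have := congrArg (Measure.map Prod.fst) hZ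
      rw [Measure.map_map (by fun_prop) (by fun_prop),
        Measure.map_map (by fun_prop) (by fun_prop)] at this
      exact this.trans (hlaw j)
    have law₂ : P.map Z₂ = μ := by
      have := congrArg (Measure.map fun z => z.2.1) hZ
      rw [Measure.map_map (by fun_prop) (by fun_prop),
        Measure.map_map (by fun_prop) (by fun_prop)] at this
      exact this.trans (hlaw j)
    have law₃ : P.map Z₃ = μ := by
      have := congrArg (Measure.map fun z => z.2.2) hZ
      rw [Measure.map_map (by fun_prop) (by fun_prop),
        Measure.map_map (by fun_prop) (by fun_prop)] at this
      exact this.trans (hlaw j)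
    have hdist := lintegral_coupling_le hμ (hX j) (hX j) (hX j) m₁ m₂ m₃ (hlaw j) (hlaw j)
      (hlaw j) law₁ law₂ law₃ ht
    refine enorm_integral_mul_le_of_coupling hL hg hdeg hδ hδ1 (hX j) (hX k) (hX l) (hX m) m₁
      (hX k) (hX l) (hX m) law₁ hind
      (le_trans (lintegral_mono fun ω => ENNReal.ofReal_le_ofReal ?_) hdist)
      (le_trans (lintegral_mono fun ω => ENNReal.ofReal_le_ofReal ?_) hdist) hGp hG2
      (hG j k hjk) (hG l m hlm) ?_ (hG l m hlm)
    · rw [sub_self, l1norm_zero, l1norm_sub_comm]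
      linarith [l1norm_nonneg (Z₂ ω - X j ω), l1norm_nonneg (Z₃ ω - X j ω)]
    · rw [sub_self, sub_self, l1norm_zero]
      linarith [l1norm_nonneg (Z₁ ω - X j ω), l1norm_nonneg (Z₂ ω - X j ω),
        l1norm_nonneg (Z₃ ω - X j ω)]
    · have hind₁ : IndepFun Z₁ (X k) P := hind.comp measurable_id measurable_fst
      rw [(indepFun_iff_map_prod_eq_prod_map_map m₁.aemeasurable (hX k).aemeasurable).1 hind₁,
        hlaw, law₁]
      exact hGprod

theorem integral_sq_sum_sum_erase {Ω : Type*} [MeasurableSpace Ω] {P : Measure Ω}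
    {f : ℕ → ℕ → Ω → ℝ} (s : Finset ℕ) (hf : ∀ j k, j ≠ k → MemLp (f j k) 2 P) :
    ∫ ω, (∑ j ∈ s, ∑ k ∈ s.erase j, f j k ω) ^ 2 ∂P
      = ∑ j ∈ s, ∑ k ∈ s.erase j, ∑ l ∈ s, ∑ m ∈ s.erase l, ∫ ω, f j k ω * f l m ω ∂P := by
  have hint : ∀ j k l m, k ∈ s.erase j → m ∈ s.erase l →
      Integrable (fun ω => f j k ω * f l m ω) P := fun j k l m hk hm =>
    (hf j k (Finset.ne_of_mem_erase hk).symm).integrable_mul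
      (hf l m (Finset.ne_of_mem_erase hm).symm)
  have hint₁ : ∀ j k l, k ∈ s.erase j →
      Integrable (fun ω => ∑ m ∈ s.erase l, f j k ω * f l m ω) P := fun j k l hk =>
    integrable_finsetSum _ fun m hm => hint j k l m hk hm
  have hint₂ : ∀ j k, k ∈ s.erase j →
      Integrable (fun ω => ∑ l ∈ s, ∑ m ∈ s.erase l, f j k ω * f l m ω) P := fun j k hk =>
    integrable_finsetSum _ fun l _ => hint₁ j k l hk
  simp_rw [sq, Finset.sum_mul, Finset.mul_sum]
  rw [integral_finsetSum _ fun j _ => integrable_finsetSum _ fun k hk => hint₂ j k hk]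
  refine Finset.sum_congr rfl fun j _ => ?_
  rw [integral_finsetSum _ fun k hk => hint₂ j k hk]
  refine Finset.sum_congr rfl fun k hk => ?_
  rw [integral_finsetSum _ fun l _ => hint₁ j k l hk]
  exact Finset.sum_congr rfl fun l _ => integral_finsetSum _ fun m hm => hint j k l m hk hm

theorem memLp_two_of_lintegral_sq_ne_top {α : Type*} [MeasurableSpace α] {μ : Measure α}
    {f : α → ℝ} (hf : AEStronglyMeasurable f μ) (h : ∫⁻ x, ‖f x‖ₑ ^ (2 : ℝ) ∂μ ≠ ∞) :
    MemLp f 2 μ := by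
  refine ⟨hf, (eLpNorm_lt_top_iff_lintegral_rpow_enorm_lt_top two_ne_zero (by simp)).2 ?_⟩
  simpa using h.lt_top

theorem summable_two_mul_add_one_mul_ite {t : ℕ → ℝ} (ht : ∀ r, 0 ≤ t r)
    (hs : Summable fun r : ℕ => (r : ℝ) * t r) :
    Summable fun r : ℕ => (2 * (r : ℝ) + 1) * if r = 0 then 1 else t r := by
  refine ((summable_nat_add_iff 1).1 ?_)
  refine Summable.of_nonneg_of_le (fun r => ?_) (fun r => ?_)
    (((summable_nat_add_iff 1).2 hs).mul_left 3)
  · have := ht (r + 1)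
    simp only [Nat.add_eq_zero_iff, one_ne_zero, and_false, if_false]
    positivity
  · have := ht (r + 1)
    simp only [Nat.add_eq_zero_iff, one_ne_zero, and_false, if_false]
    push_cast
    have h : (0 : ℝ) ≤ r * t (r + 1) := by positivity
    linarith

theorem integral_sq_sum_sum_erase_le {d : ℕ} {Ω : Type*} [MeasurableSpace Ω] {P : Measure Ω}
    [IsProbabilityMeasure P] {X : ℕ → Ω → Fin d → ℝ} (hX : ∀ n, Measurable (X n))
    {μ : Measure (Fin d → ℝ)} (hμ : Integrable l1norm μ) (hlaw : ∀ n, P.map (X n) = μ)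
    {τ : ℕ → ℝ} (hτ : ∀ r, 0 ≤ τ r)
    (hcoupling : ∀ (u : ℕ) (s : Fin u → ℕ) (r t₁ t₂ t₃ : ℕ), Monotone s → 1 ≤ r →
      (∀ i, s i + r ≤ t₁) → t₁ ≤ t₂ → t₂ ≤ t₃ →
      HasCoupling P (fun ω (i : Fin u) => X (s i) ω) (X t₁) (X t₂) (X t₃) (τ r))
    {L : ℝ} (hL : 0 ≤ L) {g : (Fin d → ℝ) → (Fin d → ℝ) → ℝ} (hg : IsL1Lipschitz L g)
    (hsymm : ∀ x y, g x y = g y x) (hdeg : ∀ y, ∫ x, g x y ∂μ = 0)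
    {δ : ℝ} (hδ : 0 < δ) (hδ1 : δ < 1) (hτs : Summable fun r : ℕ => (r : ℝ) * τ r ^ δ)
    {η : ℝ≥0∞} {ε : ℝ} (hε : 0 ≤ ε) (hη : 2 * η ≤ ENNReal.ofReal ε)
    (hη' : 2 * (ENNReal.ofReal L ^ δ * (4 * η) ^ (1 - δ)) ≤ ENNReal.ofReal ε)
    {G : Set (Measure ((Fin d → ℝ) × (Fin d → ℝ)))}
    (hGp : ∀ Q ∈ G, ∫⁻ z, ‖g z.1 z.2‖ₑ ^ (1 + (1 - δ)⁻¹) ∂Q ≤ η)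
    (hG2 : ∀ Q ∈ G, ∫⁻ z, ‖g z.1 z.2‖ₑ ^ (2 : ℝ) ∂Q ≤ η)
    (hG : ∀ j k, j ≠ k → P.map (fun ω => (X j ω, X k ω)) ∈ G) (hGprod : μ.prod μ ∈ G)
    (s : Finset ℕ) :
    ∫ ω, (∑ j ∈ s, ∑ k ∈ s.erase j, g (X j ω) (X k ω)) ^ 2 ∂P
      ≤ 12 * (s.card : ℝ) ^ 2 *
        (ε * ∑' r : ℕ, (2 * (r : ℝ) + 1) * if r = 0 then 1 else τ r ^ δ) := by
  have hη_top : η ≠ ∞ := by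
    rintro rfl
    simp at hη
  have hLp : ∀ Q ∈ G, MemLp (fun z => g z.1 z.2) 2 Q := fun Q hQ =>
    memLp_two_of_lintegral_sq_ne_top hg.measurable_uncurry.aestronglyMeasurable
      (ne_top_of_le_ne_top hη_top (hG2 Q hQ))
  have hpair : ∀ j k, Measurable fun ω => (X j ω, X k ω) := fun j k => (hX j).prodMk (hX k)
  have hmoment : ∀ j k, j ≠ k → ∫⁻ ω, ‖g (X j ω) (X k ω)‖ₑ ^ (2 : ℝ) ∂P ≤ η := by
    intro j k hjk
    have := hG2 _ (hG j k hjk)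
    rwa [lintegral_map (hg.measurable_uncurry.enorm.pow_const _) (hpair j k)] at this
  have hXLp : ∀ j k, j ≠ k → MemLp (fun ω => g (X j ω) (X k ω)) 2 P := fun j k hjk =>
    (hLp _ (hG j k hjk)).comp_of_map (hpair j k).aemeasurable
  set w : ℕ → ℝ := fun r => if r = 0 then 1 else τ r ^ δ with hw
  have hw0 : ∀ r, 0 ≤ w r := fun r => by
    have := Real.rpow_nonneg (hτ r) δ
    simp only [hw]
    split_ifs <;> positivity
  have hws : Summable fun r : ℕ => (2 * (r : ℝ) + 1) * w r :=
    summable_two_mul_add_one_mul_ite (fun r => Real.rpow_nonneg (hτ r) δ) hτs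
  have hws' : Summable fun r : ℕ => (2 * (r : ℝ) + 1) * (ε * w r) := by
    simpa only [mul_left_comm] using hws.mul_left ε
  have hdiag : ∀ j k l m, j ≠ k → l ≠ m →
      ‖∫ ω, g (X j ω) (X k ω) * g (X l ω) (X m ω) ∂P‖ₑ ≤ ENNReal.ofReal ε := by
    intro j k l m hjk hlm
    have hm : Measurable fun ω => ‖g (X j ω) (X k ω)‖ₑ ^ (2 : ℝ) :=
      (hg.measurable_comp (hX j) (hX k)).enorm.pow_const _
    calc ‖∫ ω, g (X j ω) (X k ω) * g (X l ω) (X m ω) ∂P‖ₑ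
        ≤ ∫⁻ ω, ‖g (X j ω) (X k ω) * g (X l ω) (X m ω)‖ₑ ∂P := enorm_integral_le_lintegral_enorm _
      _ ≤ ∫⁻ ω, (‖g (X j ω) (X k ω)‖ₑ ^ (2 : ℝ) + ‖g (X l ω) (X m ω)‖ₑ ^ (2 : ℝ)) ∂P := by
          refine lintegral_mono fun ω => ?_
          have := ENNReal.mul_rpow_le_rpow_add_rpow ‖g (X j ω) (X k ω)‖ₑ ‖g (X l ω) (X m ω)‖ₑ
            zero_le_one
          rwa [ENNReal.rpow_one, one_add_one_eq_two, ← enorm_mul] at this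
      _ ≤ η + η := by
          rw [lintegral_add_left hm]
          exact add_le_add (hmoment j k hjk) (hmoment l m hlm)
      _ ≤ ENNReal.ofReal ε := by rwa [← two_mul]
  have hreal : ∀ {x t : ℝ}, 0 ≤ t → ‖x‖ₑ ≤ ENNReal.ofReal t → |x| ≤ t := by
    intro x t ht hx
    rwa [← Real.norm_eq_abs, ← ENNReal.ofReal_le_ofReal_iff ht, ofReal_norm]
  rw [integral_sq_sum_sum_erase s hXLp]
  calc ∑ j ∈ s, ∑ k ∈ s.erase j, ∑ l ∈ s, ∑ m ∈ s.erase l,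
        ∫ ω, g (X j ω) (X k ω) * g (X l ω) (X m ω) ∂P
      ≤ ∑ j ∈ s, ∑ k ∈ s.erase j, ∑ l ∈ s, ∑ m ∈ s.erase l,
        |∫ ω, g (X j ω) (X k ω) * g (X l ω) (X m ω) ∂P| := by
        gcongr
        exact le_abs_self _
    _ ≤ 12 * (s.card : ℝ) ^ 2 * ∑' r : ℕ, (2 * (r : ℝ) + 1) * (ε * w r) := by
        refine sum_sum_erase_le (F := fun j k l m =>
          |∫ ω, g (X j ω) (X k ω) * g (X l ω) (X m ω) ∂P|) (fun r => mul_nonneg hε (hw0 r)) hws'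
          (le_add_add_of_gap (fun r => mul_nonneg hε (hw0 r)) ?_ ?_ ?_ ?_ ?_) s
        · intro j k l m
          simp only [hsymm (X j _)]
        · intro j k l m
          simp only [hsymm (X l _)]
        · intro j k l m
          simp only [mul_comm]
        · intro j k l m hjk hlm
          simpa [hw] using hreal hε (hdiag j k l m hjk hlm)
        · intro j k l m r hjk hlm hr hgap
          refine hreal (mul_nonneg hε (hw0 r)) ?_
          refine (enorm_integral_mul_le_of_gap hX hμ hlaw hcoupling hL hg hdeg hδ hδ1 hGp hLp hG
            hGprod hjk hlm hr hgap).trans ?_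
          rw [ENNReal.mul_rpow_of_nonneg _ _ hδ.le, ENNReal.ofReal_rpow_of_nonneg (hτ r) hδ.le,
            ENNReal.ofReal_mul hε]
          have hwr : w r = τ r ^ δ := if_neg (by omega)
          rw [hwr]
          calc _ = 2 * (ENNReal.ofReal L ^ δ * (4 * η) ^ (1 - δ)) * ENNReal.ofReal (τ r ^ δ) := by
                ring
            _ ≤ _ := by gcongr
    _ = 12 * (s.card : ℝ) ^ 2 * (ε * ∑' r : ℕ, (2 * (r : ℝ) + 1) * w r) := by
        simp only [mul_left_comm _ ε, tsum_mul_left]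

theorem exists_ne_zero_and_mul_rpow_le {δ : ℝ} (hδ1 : δ < 1) {K ε : ℝ≥0∞}
    (hK : K ≠ ∞) (hε : ε ≠ 0) :
    ∃ η ≠ 0, 2 * η ≤ ε ∧ 2 * (K * (4 * η) ^ (1 - δ)) ≤ ε := by
  have h₁ : Filter.Tendsto (fun η : ℝ≥0∞ => 2 * η) (nhds 0) (nhds 0) := by
    simpa using (ENNReal.continuous_const_mul (a := 2) (by simp)).tendsto 0
  have h₂ : Filter.Tendsto (fun η : ℝ≥0∞ => 2 * (K * (4 * η) ^ (1 - δ))) (nhds 0) (nhds 0) := by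
    have h4 : Filter.Tendsto (fun η : ℝ≥0∞ => 4 * η) (nhds 0) (nhds 0) := by
      simpa using (ENNReal.continuous_const_mul (a := 4) (by simp)).tendsto 0
    have hpow := ((ENNReal.continuous_rpow_const (y := 1 - δ)).tendsto 0).comp h4
    rw [ENNReal.zero_rpow_of_pos (by linarith)] at hpow
    have := ENNReal.Tendsto.const_mul (a := 2)
      (ENNReal.Tendsto.const_mul (a := K) hpow (Or.inr hK)) (Or.inr (by simp))
    simpa using this
  have hev := ((h₁.eventually_le_const (pos_iff_ne_zero.2 hε)).and
    (h₂.eventually_le_const (pos_iff_ne_zero.2 hε)))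
  obtain ⟨η, hη, h⟩ := ((hev.filter_mono nhdsWithin_le_nhds).and
    (self_mem_nhdsWithin (a := (0 : ℝ≥0∞)) (s := Set.Ioi 0))).exists
  exact ⟨η, (Set.mem_Ioi.1 h).ne', hη⟩

theorem abs_max_neg_min_sub_le (c a b : ℝ) :
    |max (-c) (min c a) - max (-c) (min c b)| ≤ |a - b| := by
  refine (abs_max_sub_max_le_max _ _ _ _).trans (max_le (by simp) ?_)
  exact (abs_min_sub_min_le_max _ _ _ _).trans (max_le (by simp) le_rfl)

theorem abs_sub_max_neg_min_le {c : ℝ} (hc : 0 ≤ c) (a : ℝ) :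
    |a - max (-c) (min c a)| ≤ |a| := by
  rcases le_total a c with h₁ | h₁
  · rw [min_eq_right h₁]
    rcases le_total (-c) a with h₂ | h₂
    · simp [max_eq_right h₂]
    · rw [max_eq_left h₂, abs_of_nonpos (by linarith), abs_of_nonpos (by linarith)]
      linarith
  · rw [min_eq_left h₁, max_eq_right (by linarith), abs_of_nonneg (by linarith),
      abs_of_nonneg (by linarith)]
    linarith

theorem IsL1Lipschitz.sub {d : ℕ} {L L' : ℝ} {e e' : (Fin d → ℝ) → (Fin d → ℝ) → ℝ}
    (he : IsL1Lipschitz L e) (he' : IsL1Lipschitz L' e') :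
    IsL1Lipschitz (L + L') fun x y => e x y - e' x y := fun x x' y y' => by
  have h₁ := abs_le.1 (he x x' y y')
  have h₂ := abs_le.1 (he' x x' y y')
  rw [abs_le, add_mul]
  constructor <;> linarith [h₁.1, h₁.2, h₂.1, h₂.2]

theorem IsL1Lipschitz.max_neg_min {d : ℕ} {L : ℝ} {e : (Fin d → ℝ) → (Fin d → ℝ) → ℝ}
    (he : IsL1Lipschitz L e) (c : ℝ) :
    IsL1Lipschitz L fun x y => max (-c) (min c (e x y)) := fun x x' y y' =>
  (abs_max_neg_min_sub_le c _ _).trans (he x x' y y')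

theorem degenerateVersion_sub_of_degenerate {d : ℕ} {μ : Measure (Fin d → ℝ)}
    [IsProbabilityMeasure μ] (hμ : Integrable l1norm μ) {L L' : ℝ}
    {e t : (Fin d → ℝ) → (Fin d → ℝ) → ℝ} (he : IsL1Lipschitz L e) (ht : IsL1Lipschitz L' t)
    (hsymm : ∀ x y, e x y = e y x) (hdeg : ∀ y, ∫ x, e x y ∂μ = 0) (x y : Fin d → ℝ) :
    degenerateVersion μ (fun x y => e x y - t x y) x y = e x y - degenerateVersion μ t x y := by
  have h₁ : ∫ x', (e x' y - t x' y) ∂μ = -∫ x', t x' y ∂μ := by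
    rw [integral_sub (he.integrable_left hμ y) (ht.integrable_left hμ y), hdeg, zero_sub]
  have h₂ : ∀ x, ∫ y', (e x y' - t x y') ∂μ = -∫ y', t x y' ∂μ := fun x => by
    rw [integral_sub (he.swap.integrable_left hμ x) (ht.swap.integrable_left hμ x)]
    simp only [hsymm x, hdeg, zero_sub]
  simp only [degenerateVersion, h₁, h₂, integral_neg]
  ring

theorem IsL1Lipschitz.integral_map_left {d : ℕ} {Ω : Type*} [MeasurableSpace Ω] {P : Measure Ω}
    {Y : Ω → Fin d → ℝ} (hY : Measurable Y) {L : ℝ} {e : (Fin d → ℝ) → (Fin d → ℝ) → ℝ}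
    (he : IsL1Lipschitz L e) (y : Fin d → ℝ) :
    ∫ x, e x y ∂(P.map Y) = ∫ ω, e (Y ω) y ∂P :=
  integral_map hY.aemeasurable
    (he.measurable_comp measurable_id measurable_const).aestronglyMeasurable

theorem degenerateVersion_map {d : ℕ} {Ω : Type*} [MeasurableSpace Ω] {P : Measure Ω}
    [IsProbabilityMeasure P] {Y : Ω → Fin d → ℝ} (hY : Measurable Y) {L : ℝ}
    {e : (Fin d → ℝ) → (Fin d → ℝ) → ℝ} (he : IsL1Lipschitz L e) (x y : Fin d → ℝ) :
    degenerateVersion (P.map Y) e x y = e x y - ∫ ω, e (Y ω) y ∂P - ∫ ω, e x (Y ω) ∂P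
      + ∫ ω, ∫ ω', e (Y ω) (Y ω') ∂P ∂P := by
  have : IsProbabilityMeasure (P.map Y) := Measure.isProbabilityMeasure_map hY.aemeasurable
  have hright : ∀ x, ∫ y', e x y' ∂(P.map Y) = ∫ ω, e x (Y ω) ∂P := he.swap.integral_map_left hY
  have houter : StronglyMeasurable fun x => ∫ y', e x y' ∂(P.map Y) :=
    he.measurable_uncurry.stronglyMeasurable.integral_prod_right'
  rw [degenerateVersion, he.integral_map_left hY,
    integral_map hY.aemeasurable houter.aestronglyMeasurable]
  simp only [hright]

section Stationary

variable {Ω E : Type*} [MeasurableSpace Ω] [MeasurableSpace E] {P : Measure Ω} {X : ℕ → Ω → E}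

theorem map_eq_of_stationary (hX : ∀ n, Measurable (X n))
    (hstat : ∀ (m : ℕ) (k : Fin m → ℕ) (l : ℕ),
      P.map (fun ω i => X (k i + l) ω) = P.map (fun ω i => X (k i) ω)) (n : ℕ) :
    P.map (X n) = P.map (X 1) := by
  have hshift : ∀ k l, P.map (X (k + l)) = P.map (X k) := fun k l => by
    have := congrArg (Measure.map fun v : Fin 1 → E => v 0) (hstat 1 (fun _ => k) l)
    rwa [Measure.map_map (by fun_prop) (by fun_prop),
      Measure.map_map (by fun_prop) (by fun_prop)] at this
  rw [← hshift n 1, add_comm, hshift 1 n]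

theorem map_prodMk_eq_of_stationary (hX : ∀ n, Measurable (X n))
    (hstat : ∀ (m : ℕ) (k : Fin m → ℕ) (l : ℕ),
      P.map (fun ω i => X (k i + l) ω) = P.map (fun ω i => X (k i) ω)) (j r : ℕ) :
    P.map (fun ω => (X j ω, X (j + r) ω)) = P.map (fun ω => (X 1 ω, X (1 + r) ω)) := by
  have hshift : ∀ a b l, P.map (fun ω => (X (a + l) ω, X (b + l) ω))
      = P.map (fun ω => (X a ω, X b ω)) := fun a b l => by
    have := congrArg (Measure.map fun v : Fin 2 → E => (v 0, v 1)) (hstat 2 ![a, b] l)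
    rwa [Measure.map_map (by fun_prop) (by fun_prop),
      Measure.map_map (by fun_prop) (by fun_prop)] at this
  rw [← hshift j (j + r) 1, ← hshift 1 (1 + r) j, add_comm j 1,
    show j + r + 1 = 1 + r + j by omega]

end Stationary

theorem isAdmissiblePair_map {Ω E : Type*} [MeasurableSpace Ω] [MeasurableSpace E] {P : Measure Ω}
    {μ : Measure E} {h : E → E → ℝ} (hh : Measurable fun z : E × E => h z.1 z.2) {ν : ℝ}
    {C : ℝ≥0∞} {Y Z : Ω → E} (hY : Measurable Y) (hZ : Measurable Z) (hYμ : P.map Y = μ)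
    (hZμ : P.map Z = μ) (hC : ∫⁻ ω, ‖h (Y ω) (Z ω)‖ₑ ^ ν ∂P ≤ C) :
    IsAdmissiblePair μ h ν C (P.map fun ω => (Y ω, Z ω)) where
  map_fst := by
    rw [Measure.map_map measurable_fst (hY.prodMk hZ)]
    exact hYμ
  map_snd := by
    rw [Measure.map_map measurable_snd (hY.prodMk hZ)]
    exact hZμ
  lintegral_le := by
    rwa [lintegral_map (hh.enorm.pow_const _) (hY.prodMk hZ)]

theorem lintegral_enorm_rpow_eq_ofReal {α : Type*} [MeasurableSpace α] {μ : Measure α}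
    {f : α → ℝ} {ν : ℝ} (hν : 0 ≤ ν) (hf : Integrable (fun x => |f x| ^ ν) μ) :
    ∫⁻ x, ‖f x‖ₑ ^ ν ∂μ = ENNReal.ofReal (∫ x, |f x| ^ ν ∂μ) := by
  rw [ofReal_integral_eq_lintegral_ofReal hf
    (ae_of_all _ fun x => Real.rpow_nonneg (abs_nonneg _) _)]
  refine lintegral_congr fun x => ?_
  rw [← ENNReal.ofReal_rpow_of_nonneg (abs_nonneg _) hν, ← Real.norm_eq_abs, ofReal_norm]

/-- Kernel truncation for degenerate U-statistics of τ-weakly dependent data: under the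
stationarity, coupling, degeneracy, Lipschitz and moment assumptions, the truncated and
re-degenerated kernels `h_c` satisfy `lim_{c→∞} sup_n n² E(U_n − U_{n,c})² = 0`. -/
theorem kernel_truncation_U_statistics
    {Ω : Type*} [MeasureSpace Ω] [IsProbabilityMeasure (ℙ : Measure Ω)]
    (d : ℕ) (X : ℕ → Ω → (Fin d → ℝ)) (hXmeas : ∀ n, Measurable (X n))
    -- strict stationarity
    (hstat : ∀ (m : ℕ) (k : Fin m → ℕ) (l : ℕ),
      Measure.map (fun ω i => X (k i + l) ω) ℙ = Measure.map (fun ω i => X (k i) ω) ℙ)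
    (hXint : Integrable (fun ω => ∑ i, |X 1 ω i|) ℙ)
    -- τ-dependence coefficients
    (δ : ℝ) (hδ : 0 < δ) (hδ1 : δ < 1)
    (τ : ℕ → ℝ) (hτ0 : ∀ r, 0 ≤ τ r)
    (hτsum : Summable (fun r : ℕ => (r : ℝ) * τ r ^ δ))
    -- L¹-coupling characterization of τ-dependence
    (hcoupling : ∀ (u : ℕ) (s : Fin u → ℕ) (r t₁ t₂ t₃ : ℕ), Monotone s → 1 ≤ r →
      (∀ i, s i + r ≤ t₁) → t₁ ≤ t₂ → t₂ ≤ t₃ →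
      ∃ Xt₁ Xt₂ Xt₃ : Ω → (Fin d → ℝ),
        Measurable Xt₁ ∧ Measurable Xt₂ ∧ Measurable Xt₃ ∧
        Measure.map (fun ω => (Xt₁ ω, Xt₂ ω, Xt₃ ω)) ℙ
          = Measure.map (fun ω => (X t₁ ω, X t₂ ω, X t₃ ω)) ℙ ∧
        IndepFun (fun ω (i : Fin u) => X (s i) ω) (fun ω => (Xt₁ ω, Xt₂ ω, Xt₃ ω)) ℙ ∧
        ∫ ω, ((∑ i, |Xt₁ ω i - X t₁ ω i|) + (∑ i, |Xt₂ ω i - X t₂ ω i|)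
            + ∑ i, |Xt₃ ω i - X t₃ ω i|) ∂ℙ ≤ τ r)
    -- the kernel: symmetric, Lipschitz, degenerate
    (h : (Fin d → ℝ) → (Fin d → ℝ) → ℝ)
    (hsymm : ∀ x y, h x y = h y x)
    (Lh : ℝ) (hLip : ∀ x x' y y',
      |h x y - h x' y'| ≤ Lh * ((∑ i, |x i - x' i|) + ∑ i, |y i - y' i|))
    (hdeg : ∀ y, ∫ ω, h (X 1 ω) y ∂ℙ = 0)
    -- moment conditions
    (ν : ℝ) (hν : (2 - δ) / (1 - δ) < ν)
    (Cm : ℝ)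
    (hmomint : ∀ k : ℕ, 1 ≤ k → Integrable (fun ω => |h (X 1 ω) (X (1 + k) ω)| ^ ν) ℙ)
    (hmom : ∀ k : ℕ, 1 ≤ k → ∫ ω, |h (X 1 ω) (X (1 + k) ω)| ^ ν ∂ℙ ≤ Cm)
    (Xc : Ω → (Fin d → ℝ)) (hXcmeas : Measurable Xc)
    (hXcdist : Measure.map Xc ℙ = Measure.map (X 1) ℙ)
    (hXcindep : IndepFun (X 1) Xc ℙ)
    (hmomc : Integrable (fun ω => |h (X 1 ω) (Xc ω)| ^ ν) ℙ)
    -- `cbound c` is the maximum of `|h|` over `[-c,c]^d × [-c,c]^d`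
    (cbound : ℝ → ℝ)
    (hcb : ∀ c : ℝ, 0 < c → IsGreatest
      {v : ℝ | ∃ x y : Fin d → ℝ, (∀ i, |x i| ≤ c) ∧ (∀ i, |y i| ≤ c) ∧ v = |h x y|}
      (cbound c))
    -- the truncated kernel and its degenerate version
    (htr : ℝ → (Fin d → ℝ) → (Fin d → ℝ) → ℝ)
    (hhtr : ∀ c x y, htr c x y = max (-(cbound c)) (min (cbound c) (h x y)))
    (hc : ℝ → (Fin d → ℝ) → (Fin d → ℝ) → ℝ)
    (hhc : ∀ c x y, hc c x y = htr c x y - (∫ ω, htr c (X 1 ω) y ∂ℙ)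
      - (∫ ω, htr c x (X 1 ω) ∂ℙ) + ∫ ω, ∫ ω', htr c (X 1 ω) (X 1 ω') ∂ℙ ∂ℙ)
    -- the U-statistics
    (U : ℕ → Ω → ℝ)
    (hU : ∀ n ω, U n ω = ((n : ℝ) ^ 2)⁻¹ *
      ∑ j ∈ Finset.Icc 1 n, ∑ k ∈ (Finset.Icc 1 n).erase j, h (X j ω) (X k ω))
    (Uc : ℝ → ℕ → Ω → ℝ)
    (hUc : ∀ c n ω, Uc c n ω = ((n : ℝ) ^ 2)⁻¹ *
      ∑ j ∈ Finset.Icc 1 n, ∑ k ∈ (Finset.Icc 1 n).erase j, hc c (X j ω) (X k ω)) :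
    -- conclusion: lim_{c→∞} sup_{n∈ℕ} n² E(U_n − U_{n,c})² = 0
    ∀ ε > (0 : ℝ), ∃ c₀ : ℝ, ∀ c ≥ c₀, ∀ n : ℕ,
      (n : ℝ) ^ 2 * ∫ ω, (U n ω - Uc c n ω) ^ 2 ∂ℙ ≤ ε := by
  set μ : Measure (Fin d → ℝ) := Measure.map (X 1) ℙ with hμdef
  have : IsProbabilityMeasure μ := Measure.isProbabilityMeasure_map (hXmeas 1).aemeasurable
  have hμ : Integrable l1norm μ :=
    (integrable_map_measure measurable_l1norm.aestronglyMeasurable (hXmeas 1).aemeasurable).2 hXint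
  have hlaw : ∀ n, Measure.map (X n) ℙ = μ := map_eq_of_stationary hXmeas hstat
  have hL : 0 ≤ max Lh 0 := le_max_right _ _
  have hLip' : IsL1Lipschitz (max Lh 0) h := fun x x' y y' =>
    (hLip x x' y y').trans (mul_le_mul_of_nonneg_right (le_max_left _ _)
      (add_nonneg (l1norm_nonneg (x - x')) (l1norm_nonneg (y - y'))))
  have hdegμ : ∀ y, ∫ x, h x y ∂μ = 0 := fun y =>
    (hLip'.integral_map_left (hXmeas 1) y).trans (hdeg y)
  have hp2 : 2 < 1 + (1 - δ)⁻¹ := by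
    have := (one_lt_inv₀ (by linarith : 0 < 1 - δ)).2 (by linarith)
    linarith
  have hpν : 1 + (1 - δ)⁻¹ < ν := by
    have : (2 - δ) / (1 - δ) = 1 + (1 - δ)⁻¹ := by
      field_simp [show (1 - δ) ≠ 0 by linarith]
      ring
    rwa [← this]
  have hν0 : 0 ≤ ν := by linarith
  set C : ℝ≥0∞ := max (ENNReal.ofReal Cm) (∫⁻ ω, ‖h (X 1 ω) (Xc ω)‖ₑ ^ ν ∂ℙ) with hCdef
  have hC : C ≠ ∞ := by
    rw [hCdef, lintegral_enorm_rpow_eq_ofReal hν0 hmomc]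
    exact (max_lt ENNReal.ofReal_lt_top ENNReal.ofReal_lt_top).ne
  have hmoment : ∀ j r, 1 ≤ r → ∫⁻ ω, ‖h (X j ω) (X (j + r) ω)‖ₑ ^ ν ∂ℙ ≤ C := by
    intro j r hr
    have hm : Measurable fun z : (Fin d → ℝ) × (Fin d → ℝ) => ‖h z.1 z.2‖ₑ ^ ν :=
      hLip'.measurable_uncurry.enorm.pow_const _
    have heq := congrArg (fun Q => ∫⁻ z, ‖h z.1 z.2‖ₑ ^ ν ∂Q)
      (map_prodMk_eq_of_stationary hXmeas hstat j r)
    rw [lintegral_map hm ((hXmeas _).prodMk (hXmeas _)),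
      lintegral_map hm ((hXmeas _).prodMk (hXmeas _))] at heq
    rw [heq, lintegral_enorm_rpow_eq_ofReal hν0 (hmomint r hr)]
    exact (ENNReal.ofReal_le_ofReal (hmom r hr)).trans (le_max_left _ _)
  have hpair : ∀ j k, j ≠ k →
      IsAdmissiblePair μ h ν C (Measure.map (fun ω => (X j ω, X k ω)) ℙ) := by
    intro j k hjk
    refine isAdmissiblePair_map hLip'.measurable_uncurry (hXmeas j) (hXmeas k) (hlaw j) (hlaw k) ?_
    rcases lt_or_gt_of_ne hjk with hlt | hlt
    · obtain ⟨r, rfl⟩ := Nat.exists_eq_add_of_le hlt.le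
      exact hmoment j r (by omega)
    · obtain ⟨r, rfl⟩ := Nat.exists_eq_add_of_le hlt.le
      simp only [hsymm (X (k + r) _)]
      exact hmoment k r (by omega)
  have hprod : IsAdmissiblePair μ h ν C (μ.prod μ) := by
    have hmap := (indepFun_iff_map_prod_eq_prod_map_map (hXmeas 1).aemeasurable
      hXcmeas.aemeasurable).1 hXcindep
    rw [hXcdist] at hmap
    rw [← hmap]
    exact isAdmissiblePair_map hLip'.measurable_uncurry (hXmeas 1) hXcmeas rfl hXcdist
      (le_max_right _ _)
  have hprod' : ∫⁻ y, ∫⁻ x, ‖h x y‖ₑ ^ ν ∂μ ∂μ ≤ C := by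
    have hm : Measurable fun z : (Fin d → ℝ) × (Fin d → ℝ) => ‖h z.1 z.2‖ₑ ^ ν :=
      hLip'.measurable_uncurry.enorm.pow_const _
    have := hprod.lintegral_le
    rwa [lintegral_prod_symm' _ hm] at this
  have hhtr' : ∀ c, htr c = fun x y => max (-(cbound c)) (min (cbound c) (h x y)) := fun c =>
    funext₂ (hhtr c)
  have htrL : ∀ c, IsL1Lipschitz (max Lh 0) (htr c) := fun c => by
    rw [hhtr' c]
    exact hLip'.max_neg_min _
  set e : ℝ → (Fin d → ℝ) → (Fin d → ℝ) → ℝ := fun c x y => h x y - htr c x y with he_def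
  have he : ∀ c, IsL1Lipschitz (max Lh 0 + max Lh 0) (e c) := fun c => hLip'.sub (htrL c)
  have hesymm : ∀ c x y, e c x y = e c y x := fun c x y => by
    simp only [he_def, hhtr, hsymm x y]
  have hebox : ∀ c, 0 < c → ∀ x y : Fin d → ℝ, (∀ i, |x i| ≤ c) → (∀ i, |y i| ≤ c) →
      e c x y = 0 := by
    intro c hc0 x y hx hy
    have hb := abs_le.1 ((hcb c hc0).2 ⟨x, y, hx, hy, rfl⟩)
    simp only [he_def, hhtr, min_eq_right hb.2, max_eq_right hb.1, sub_self]
  have hele : ∀ c, 0 < c → ∀ x y, |e c x y| ≤ |h x y| := by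
    intro c hc0 x y
    obtain ⟨x', y', -, -, hv⟩ := (hcb c hc0).1
    simp only [he_def, hhtr]
    exact abs_sub_max_neg_min_le (hv ▸ abs_nonneg _) _
  have hdeg_eq : ∀ c x y, degenerateVersion μ (e c) x y = h x y - hc c x y := fun c x y => by
    rw [hhc, ← degenerateVersion_map (hXmeas 1) (htrL c)]
    exact degenerateVersion_sub_of_degenerate hμ hLip' (htrL c) hsymm hdegμ x y
  intro ε hε
  set S : ℝ := ∑' r : ℕ, (2 * (r : ℝ) + 1) * if r = 0 then 1 else τ r ^ δ with hS
  have hS0 : 0 ≤ S := tsum_nonneg fun r => by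
    have := Real.rpow_nonneg (hτ0 r) δ
    split_ifs <;> positivity
  have hε' : 0 < ε / (12 * S + 1) := by positivity
  obtain ⟨η, hη0, hη, hη'⟩ := exists_ne_zero_and_mul_rpow_le hδ1
    (K := ENNReal.ofReal (2 * (max Lh 0 + max Lh 0)) ^ δ)
    (ENNReal.rpow_ne_top_of_nonneg hδ.le ENNReal.ofReal_ne_top) (ENNReal.ofReal_pos.2 hε').ne'
  obtain ⟨c₁, -, hp⟩ := exists_forall_lintegral_degenerateVersion_le hμ (add_nonneg hL hL)
    (fun c _ => he c) hesymm hele hebox hC hprod' (by linarith) hpν hη0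
  obtain ⟨c₂, -, h2⟩ := exists_forall_lintegral_degenerateVersion_le hμ (add_nonneg hL hL)
    (fun c _ => he c) hesymm hele hebox hC hprod' one_le_two (hp2.trans hpν) hη0
  refine ⟨max c₁ c₂, fun c hc₀ n => ?_⟩
  have hbound := integral_sq_sum_sum_erase_le hXmeas hμ hlaw hτ0 hcoupling
    (mul_nonneg zero_le_two (add_nonneg hL hL)) ((he c).degenerateVersion hμ)
    (degenerateVersion_symm μ (hesymm c)) ((he c).integral_degenerateVersion hμ) hδ hδ1 hτsum
    hε'.le hη hη' (G := {Q | IsAdmissiblePair μ h ν C Q}) (hp c ((le_max_left _ _).trans hc₀))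
    (h2 c ((le_max_right _ _).trans hc₀)) hpair hprod (Finset.Icc 1 n)
  rw [Nat.card_Icc, Nat.add_sub_cancel] at hbound
  have hdiff : ∀ ω, (U n ω - Uc c n ω) ^ 2 = (((n : ℝ) ^ 2)⁻¹) ^ 2 *
      (∑ j ∈ Finset.Icc 1 n, ∑ k ∈ (Finset.Icc 1 n).erase j,
        degenerateVersion μ (e c) (X j ω) (X k ω)) ^ 2 := fun ω => by
    simp only [hU, hUc, hdeg_eq, Finset.sum_sub_distrib]
    ring
  simp only [hdiff]
  rw [integral_const_mul]
  rcases Nat.eq_zero_or_pos n with rfl | hn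
  · simpa using hε.le
  have hn0 : (n : ℝ) ≠ 0 := by positivity
  calc _ ≤ (n : ℝ) ^ 2 * ((((n : ℝ) ^ 2)⁻¹) ^ 2 *
        (12 * (n : ℝ) ^ 2 * (ε / (12 * S + 1) * S))) := by gcongr
    _ = 12 * S / (12 * S + 1) * ε := by field_simp
    _ ≤ ε := by
        refine mul_le_of_le_one_left hε.le ((div_le_one (by positivity)).2 (by linarith))
end
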